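/- For every integer k ≥ 4 there exists a plane triangulation G_k of order 22k such that s_o(G_k) ≥ 15k and s_{o'}(G_k) ≤ 14k; in particular, s_o(G_k) − s_{o'}(G_k) ≥ k. -/

import Mathlib

/-- A drawing (embedding) of a simple graph in the plane `ℝ × ℝ` without crossings:
vertices are mapped to distinct points, each edge to an injective arc joining its
endpoints, arcs pass through no other vertex, and two arcs of distinct edges meet
only in common endpoints. -/
structure PlaneEmbedding {V : Type} (G : SimpleGraph V) where
  vtx : V → ℝ × ℝ
  vtx_inj : Function.Injective vtx
  arc : ∀ ⦃u v : V⦄, G.Adj u v → Set (ℝ × ℝ)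
  arc_symm : ∀ ⦃u v : V⦄ (h : G.Adj u v), arc h.symm = arc h
  arc_path : ∀ ⦃u v : V⦄ (h : G.Adj u v),
    ∃ γ : Path (vtx u) (vtx v), Function.Injective ⇑γ ∧ Set.range ⇑γ = arc h
  arc_vtx : ∀ ⦃u v : V⦄ (h : G.Adj u v) (w : V), vtx w ∈ arc h → w = u ∨ w = v
  arc_inter : ∀ ⦃u v a b : V⦄ (h₁ : G.Adj u v) (h₂ : G.Adj a b), s(u, v) ≠ s(a, b) →
    arc h₁ ∩ arc h₂ ⊆ ({vtx u, vtx v} : Set (ℝ × ℝ)) ∩ {vtx a, vtx b}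

namespace PlaneEmbedding

variable {V : Type} {G : SimpleGraph V}

/-- The point set of the sub-drawing determined by the vertices in `S`
(the inherited embedding of the induced subgraph on `S`). -/
def subSupport (E : PlaneEmbedding G) (S : Set V) : Set (ℝ × ℝ) :=
  E.vtx '' S ∪ ⋃ (u : V) (_ : u ∈ S) (v : V) (_ : v ∈ S) (h : G.Adj u v), E.arc h

/-- The induced subgraph on `S`, with the inherited embedding, is an outerplane graph:
every vertex of `S` lies on the boundary of the outer (unbounded) face, i.e. in the
closure of the set of points belonging to unbounded faces of the sub-drawing. -/
def OuterplaneOn (E : PlaneEmbedding G) (S : Set V) : Prop :=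
  ∀ v ∈ S, E.vtx v ∈ closure {p | p ∉ E.subSupport S ∧
    ¬ Bornology.IsBounded (connectedComponentIn (E.subSupport S)ᶜ p)}

/-- The whole drawing is an outerplane graph. -/
def IsOuterplane (E : PlaneEmbedding G) : Prop := E.OuterplaneOn Set.univ

end PlaneEmbedding

/-- A graph is planar if it admits a plane embedding. -/
def IsPlanar {V : Type} (G : SimpleGraph V) : Prop := Nonempty (PlaneEmbedding G)

/-- A graph is outerplanar if it admits a plane embedding with all vertices on the
boundary of the outer face. -/
def IsOuterplanar {V : Type} (G : SimpleGraph V) : Prop :=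
  ∃ E : PlaneEmbedding G, E.IsOuterplane

/-- A plane triangulation is an edge-maximal (finite) planar graph. -/
def IsPlaneTriangulation {V : Type} (G : SimpleGraph V) : Prop :=
  IsPlanar G ∧ ∀ u v : V, u ≠ v → ¬ G.Adj u v →
    ¬ IsPlanar (G ⊔ SimpleGraph.fromEdgeSet {s(u, v)})

/-- `G` has a `K_m`-minor: there are `m` pairwise disjoint nonempty connected branch
sets with an edge between any two of them. -/
def HasCliqueMinor {V : Type} (G : SimpleGraph V) (m : ℕ) : Prop :=
  ∃ B : Fin m → Set V,
    (∀ i, (B i).Nonempty) ∧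
    (∀ i, (G.induce (B i)).Connected) ∧
    (∀ i j, i ≠ j → Disjoint (B i) (B j)) ∧
    (∀ i j, i ≠ j → ∃ u ∈ B i, ∃ v ∈ B j, G.Adj u v)

/-- `G` is `K₄`-minor free. -/
def K4MinorFree {V : Type} (G : SimpleGraph V) : Prop := ¬ HasCliqueMinor G 4

/-- `s_{o'}(G)` for a fixed plane embedding of `G`: the maximum order of an induced
subgraph whose inherited embedding is an outerplane graph. -/
noncomputable def sO' {V : Type} [Fintype V] {G : SimpleGraph V}
    (E : PlaneEmbedding G) : ℕ :=
  sSup {n | ∃ S : Finset V, E.OuterplaneOn ↑S ∧ S.card = n}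

/-- `s_o(G)`: the maximum order of an induced outerplanar subgraph of `G`. -/
noncomputable def sO {V : Type} [Fintype V] (G : SimpleGraph V) : ℕ :=
  sSup {n | ∃ S : Finset V, IsOuterplanar (G.induce (↑S : Set V)) ∧ S.card = n}

/-- `s_{K₄}(G)`: the maximum order of an induced `K₄`-minor-free subgraph of `G`. -/
noncomputable def sK4 {V : Type} [Fintype V] (G : SimpleGraph V) : ℕ :=
  sSup {n | ∃ S : Finset V, K4MinorFree (G.induce (↑S : Set V)) ∧ S.card = n}

/-- `tw(G) ≤ k`: `G` admits a tree decomposition of width at most `k`. -/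
def TreewidthLE {V : Type} (G : SimpleGraph V) (k : ℕ) : Prop :=
  ∃ (ι : Type) (T : SimpleGraph ι) (bag : ι → Set V),
    T.IsTree ∧
    (∀ v : V, ∃ i, v ∈ bag i) ∧
    (∀ u v : V, G.Adj u v → ∃ i, u ∈ bag i ∧ v ∈ bag i) ∧
    (∀ v : V, (T.induce {i | v ∈ bag i}).Connected) ∧
    (∀ i, (bag i).ncard ≤ k + 1)

/-- `G` is a `k`-tree: its vertices admit a construction order in which the first
`k+1` vertices form a complete graph and every later vertex is joined to exactly
`k` earlier, pairwise adjacent, vertices. -/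
def IsKTree (k : ℕ) {V : Type} (G : SimpleGraph V) : Prop :=
  ∃ (n : ℕ) (e : Fin n ≃ V), k + 1 ≤ n ∧
    (∀ i j : Fin n, (i : ℕ) < k + 1 → (j : ℕ) < k + 1 → i ≠ j → G.Adj (e i) (e j)) ∧
    (∀ j : Fin n, k + 1 ≤ (j : ℕ) →
      {i : Fin n | i < j ∧ G.Adj (e i) (e j)}.ncard = k ∧
      (∀ i i' : Fin n, i < j → i' < j → G.Adj (e i) (e j) → G.Adj (e i') (e j) →
        i ≠ i' → G.Adj (e i) (e i')))

/-- `S` is a dominating set of `G`. -/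
def IsDomSet {V : Type} (G : SimpleGraph V) (S : Set V) : Prop :=
  ∀ v : V, v ∈ S ∨ ∃ u ∈ S, G.Adj u v

/-- `S` is a connected dominating set of `G`. -/
def IsConnDomSet {V : Type} (G : SimpleGraph V) (S : Set V) : Prop :=
  IsDomSet G S ∧ (G.induce S).Connected

/-- The domination number `γ(G)`. -/
noncomputable def domNum {V : Type} [Fintype V] (G : SimpleGraph V) : ℕ :=
  sInf {n | ∃ S : Finset V, IsDomSet G ↑S ∧ S.card = n}

/-- The connected domination number `γ_c(G)`. -/
noncomputable def connDomNum {V : Type} [Fintype V] (G : SimpleGraph V) : ℕ :=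
  sInf {n | ∃ S : Finset V, IsConnDomSet G ↑S ∧ S.card = n}

/-- A graph is Eulerian if every vertex has even degree. -/
def IsEulerian {V : Type} (G : SimpleGraph V) : Prop :=
  ∀ v : V, Even (G.neighborSet v).ncard

/-- `G` contains a subgraph isomorphic to `H`. -/
def ContainsCopy {W V : Type} (H : SimpleGraph W) (G : SimpleGraph V) : Prop :=
  ∃ f : H →g G, Function.Injective ⇑f

/-- The complete tripartite graph `K_{1,1,3}`. -/
def K113 : SimpleGraph (Fin 5) :=
  SimpleGraph.fromEdgeSet {s(0, 1), s(0, 2), s(0, 3), s(0, 4), s(1, 2), s(1, 3), s(1, 4)}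

/-- `G` is a maximal outerplanar graph. -/
def IsMaximalOuterplanar {V : Type} (G : SimpleGraph V) : Prop :=
  IsOuterplanar G ∧ ∀ u v : V, u ≠ v → ¬ G.Adj u v →
    ¬ IsOuterplanar (G ⊔ SimpleGraph.fromEdgeSet {s(u, v)})

section KFive

open Complex unitInterval

instance contractibleSpace_unitInterval : ContractibleSpace I :=
  (convex_Icc (0 : ℝ) 1).contractibleSpace ⟨0, by simp⟩

instance locallyPathConnectedSpace_unitInterval : LocallyPathConnectedSpace I :=
  (convex_Icc (0 : ℝ) 1).locallyPathConnectedSpace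

theorem exists_continuous_log {A : Type*} [TopologicalSpace A] [SimplyConnectedSpace A]
    [LocallyPathConnectedSpace A] (f : C(A, ℂ)) (hf : ∀ x, f x ≠ 0) :
    ∃ F : C(A, ℂ), ∀ x, exp (F x) = f x := by
  obtain ⟨a₀⟩ : Nonempty A := inferInstance
  obtain ⟨F, ⟨-, hF⟩, -⟩ := isCoveringMapOn_exp.existsUnique_continuousMap_lifts f
    (a₀ := a₀) (exp_log (hf a₀)) hf
  exact ⟨F, fun x => congrFun hF x⟩

theorem log_increment_unique (L L' : C(I, ℂ)) (h : ∀ s, exp (L s) = exp (L' s)) :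
    L 1 - L 0 = L' 1 - L' 0 := by
  let f : C(I, ℂ) := ⟨fun s => exp (L s), by fun_prop⟩
  obtain ⟨F, -, hF⟩ := isCoveringMapOn_exp.existsUnique_continuousMap_lifts f
    (a₀ := 0) (e₀ := L 0) rfl (fun s => exp_ne_zero _)
  let L'' : C(I, ℂ) := ⟨fun s => L' s + (L 0 - L' 0), by fun_prop⟩
  have h1 : L = F := hF L ⟨rfl, rfl⟩
  have h2 : L'' = F := by
    refine hF L'' ⟨by simp [L''], ?_⟩
    funext s
    simp [L'', f, exp_add, exp_sub, h, exp_ne_zero]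
  have h3 : L 1 = L'' 1 := by rw [h1, h2]
  rw [h3]
  simp only [L'', ContinuousMap.coe_mk]
  ring

/-- The total variation of a logarithm of `γ - w` along a path `γ` avoiding `w` is determined
by the endpoints up to an integer multiple of `2πi`. -/
theorem exists_winding_int (γ : C(I, ℂ)) (w u₀ u₁ : ℂ)
    (h₀ : exp u₀ = γ 0 - w) (h₁ : exp u₁ = γ 1 - w) :
    ∃ n : ℤ, ∀ L : C(I, ℂ), (∀ s, exp (L s) = γ s - w) →
      L 1 - L 0 = u₁ - u₀ + n * (2 * Real.pi * Complex.I) := by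
  by_cases h : ∃ L : C(I, ℂ), ∀ s, exp (L s) = γ s - w
  · obtain ⟨L, hL⟩ := h
    obtain ⟨m₀, hm₀⟩ := exp_eq_exp_iff_exists_int.1 ((hL 0).trans h₀.symm)
    obtain ⟨m₁, hm₁⟩ := exp_eq_exp_iff_exists_int.1 ((hL 1).trans h₁.symm)
    refine ⟨m₁ - m₀, fun L' hL' => ?_⟩
    rw [log_increment_unique L' L (fun s => (hL' s).trans (hL s).symm), hm₀, hm₁]
    push_cast
    ring
  · exact ⟨0, fun L hL => (h ⟨L, hL⟩).elim⟩

/-- There is no drawing of `K₅` in the plane in which nonadjacent edges are disjoint. -/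
theorem no_independent_disjoint_kFive (P : Fin 5 → ℂ) (γ : Fin 5 → Fin 5 → C(I, ℂ))
    (h0 : ∀ a b, a < b → γ a b 0 = P a) (h1 : ∀ a b, a < b → γ a b 1 = P b)
    (hdisj : ∀ a b c d, a < b → c < d → a ≠ c → a ≠ d → b ≠ c → b ≠ d →
      ∀ s t, γ a b s ≠ γ c d t) : False := by
  have hP : ∀ x y, x < y → P x - P y ≠ 0 := by
    have key : ∀ x y : Fin 5, x < y → ∃ z w : Fin 5, z ≠ w ∧ z ≠ x ∧ z ≠ y ∧ w ≠ x ∧ w ≠ y := by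
      decide
    have hend : ∀ x z, x ≠ z → ∃ a b s, a < b ∧ γ a b s = P x ∧
        (a = x ∧ b = z ∨ a = z ∧ b = x) := by
      intro x z hxz
      rcases lt_or_gt_of_ne hxz with h | h
      · exact ⟨x, z, 0, h, h0 x z h, .inl ⟨rfl, rfl⟩⟩
      · exact ⟨z, x, 1, h, h1 z x h, .inr ⟨rfl, rfl⟩⟩
    intro x y hxy heq
    obtain ⟨z, w, hzw, hzx, hzy, hwx, hwy⟩ := key x y hxy
    obtain ⟨a, b, s, hab, hs, hc⟩ := hend x z hzx.symm
    obtain ⟨c, d, t, hcd, ht, hc'⟩ := hend y w hwy.symm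
    have := hxy.ne
    refine hdisj a b c d hab hcd ?_ ?_ ?_ ?_ s t (by rw [hs, ht]; exact sub_eq_zero.1 heq) <;>
      grind
  let A : Fin 5 → Fin 5 → ℂ := fun x y =>
    if x < y then log (P x - P y) else log (P y - P x) + Real.pi * Complex.I
  let τ : Fin 5 → Fin 5 → ℤ := fun x y => if x < y then -1 else 1
  have hA : ∀ x y, x ≠ y → exp (A x y) = P x - P y := by
    intro x y hxy
    rcases lt_or_gt_of_ne hxy with h | h
    · simp only [A, if_pos h]
      exact exp_log (hP x y h)
    · simp only [A, if_neg h.not_gt, exp_add, exp_pi_mul_I, exp_log (hP y x h)]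
      ring
  have hτ : ∀ x y, x ≠ y → A x y - A y x = τ x y * (Real.pi * Complex.I) := by
    intro x y hxy
    rcases lt_or_gt_of_ne hxy with h | h
    · simp [A, τ, if_pos h, if_neg h.not_gt]
    · simp [A, τ, if_pos h, if_neg h.not_gt]
  have hn : ∀ a b c, a < b → a ≠ c → b ≠ c → ∃ n : ℤ, ∀ L : C(I, ℂ),
      (∀ s, exp (L s) = γ a b s - P c) →
      L 1 - L 0 = A b c - A a c + n * (2 * Real.pi * Complex.I) := by
    intro a b c hab hac hbc
    exact exists_winding_int (γ a b) (P c) (A a c) (A b c)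
      (by rw [hA a c hac, h0 a b hab]) (by rw [hA b c hbc, h1 a b hab])
  choose! n hn using hn
  have rel : ∀ a b c d, a < b → c < d → a ≠ c → a ≠ d → b ≠ c → b ≠ d →
      2 * (n a b c - n a b d + n c d b - n c d a) + τ b c - τ a c - τ b d + τ a d = 0 := by
    intro a b c d hab hcd hac had hbc hbd
    let f : C(I × I, ℂ) := ⟨fun x => γ a b x.1 - γ c d x.2, by fun_prop⟩
    obtain ⟨F, hF⟩ := exists_continuous_log f
      (fun x => sub_ne_zero.2 (hdisj a b c d hab hcd hac had hbc hbd x.1 x.2))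
    have e1 := hn a b c hab hac hbc ⟨fun s => F (s, 0), by fun_prop⟩ (fun s => by
      simp [hF, f, h0 c d hcd])
    have e2 := hn a b d hab had hbd ⟨fun s => F (s, 1), by fun_prop⟩ (fun s => by
      simp [hF, f, h1 c d hcd])
    have e3 := hn c d a hcd hac.symm had.symm
      ⟨fun t => F (0, t) + Real.pi * Complex.I, by fun_prop⟩ (fun t => by
      simp [hF, f, h0 a b hab, exp_add])
    have e4 := hn c d b hcd hbc.symm hbd.symm
      ⟨fun t => F (1, t) + Real.pi * Complex.I, by fun_prop⟩ (fun t => by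
      simp [hF, f, h1 a b hab, exp_add])
    simp only [ContinuousMap.coe_mk] at e1 e2 e3 e4
    have s1 := hτ b c hbc
    have s2 := hτ a c hac
    have s3 := hτ b d hbd
    have s4 := hτ a d had
    have hpi : (Real.pi * Complex.I : ℂ) ≠ 0 :=
      mul_ne_zero (ofReal_ne_zero.2 Real.pi_ne_zero) I_ne_zero
    have : ((2 * (n a b c - n a b d + n c d b - n c d a) + τ b c - τ a c - τ b d + τ a d : ℤ) : ℂ)
        * (Real.pi * Complex.I) = 0 := by
      push_cast
      linear_combination e2 - e1 - e4 + e3 - s1 + s2 + s3 - s4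
    exact_mod_cast (mul_eq_zero.1 this).resolve_right hpi
  have r1 := rel 0 1 2 3 (by decide) (by decide) (by decide) (by decide) (by decide) (by decide)
  have r2 := rel 0 1 2 4 (by decide) (by decide) (by decide) (by decide) (by decide) (by decide)
  have r3 := rel 0 1 3 4 (by decide) (by decide) (by decide) (by decide) (by decide) (by decide)
  have r4 := rel 0 2 1 3 (by decide) (by decide) (by decide) (by decide) (by decide) (by decide)
  have r5 := rel 0 2 1 4 (by decide) (by decide) (by decide) (by decide) (by decide) (by decide)
  have r6 := rel 0 2 3 4 (by decide) (by decide) (by decide) (by decide) (by decide) (by decide)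
  have r7 := rel 0 3 1 2 (by decide) (by decide) (by decide) (by decide) (by decide) (by decide)
  have r8 := rel 0 3 1 4 (by decide) (by decide) (by decide) (by decide) (by decide) (by decide)
  have r9 := rel 0 3 2 4 (by decide) (by decide) (by decide) (by decide) (by decide) (by decide)
  have r10 := rel 0 4 1 2 (by decide) (by decide) (by decide) (by decide) (by decide) (by decide)
  have r11 := rel 0 4 1 3 (by decide) (by decide) (by decide) (by decide) (by decide) (by decide)
  have r12 := rel 0 4 2 3 (by decide) (by decide) (by decide) (by decide) (by decide) (by decide)
  have r13 := rel 1 2 3 4 (by decide) (by decide) (by decide) (by decide) (by decide) (by decide)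
  have r14 := rel 1 3 2 4 (by decide) (by decide) (by decide) (by decide) (by decide) (by decide)
  have r15 := rel 1 4 2 3 (by decide) (by decide) (by decide) (by decide) (by decide) (by decide)
  simp [τ] at r1 r2 r3 r4 r5 r6 r7 r8 r9 r10 r11 r12 r13 r14 r15
  omega

end KFive

namespace PlaneEmbedding

variable {V : Type} {G : SimpleGraph V}

theorem disjoint_subSupport (E : PlaneEmbedding G) {A B : Set V} (h : Disjoint A B) :
    Disjoint (E.subSupport A) (E.subSupport B) := by
  rw [Set.disjoint_left] at h ⊢
  intro q hA hB
  simp only [subSupport, Set.mem_union, Set.mem_image, Set.mem_iUnion] at hA hB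
  rcases hA with ⟨a, ha, rfl⟩ | ⟨u, hu, v, hv, huv, hq⟩
  · rcases hB with ⟨b, hb, hab⟩ | ⟨u, hu, v, hv, huv, hq⟩
    · exact h ha (E.vtx_inj hab ▸ hb)
    · rcases E.arc_vtx huv a hq with rfl | rfl
      · exact h ha hu
      · exact h ha hv
  · rcases hB with ⟨b, hb, rfl⟩ | ⟨a, ha, b, hb, hab, hq'⟩
    · rcases E.arc_vtx huv b hq with rfl | rfl
      · exact h hu hb
      · exact h hv hb
    · have hne : s(u, v) ≠ s(a, b) := by
        intro he
        rcases Sym2.eq_iff.1 he with ⟨rfl, -⟩ | ⟨rfl, -⟩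
        · exact h hu ha
        · exact h hu hb
      have hi := (E.arc_inter huv hab hne ⟨hq, hq'⟩).1
      rcases hi with rfl | rfl
      · rcases E.arc_vtx hab u hq' with rfl | rfl
        · exact h hu ha
        · exact h hu hb
      · rcases E.arc_vtx hab v hq' with rfl | rfl
        · exact h hv ha
        · exact h hv hb

end PlaneEmbedding

/-- `u` and `v` are joined by a walk of `G` all of whose vertices lie in `A`. -/
def SimpleGraph.ConnIn {V : Type} (G : SimpleGraph V) (A : Set V) (u v : V) : Prop :=
  u ∈ A ∧ Relation.ReflTransGen (fun x y => G.Adj x y ∧ y ∈ A) u v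

namespace SimpleGraph.ConnIn

variable {V : Type} {G H : SimpleGraph V} {A B : Set V} {u v w : V}

theorem right_mem (h : G.ConnIn A u v) : v ∈ A := by
  obtain ⟨hu, h⟩ := h
  induction h with
  | refl => exact hu
  | tail _ h _ => exact h.2

theorem refl (hu : u ∈ A) : G.ConnIn A u u := ⟨hu, .refl⟩

theorem of_adj (h : G.Adj u v) (hu : u ∈ A) (hv : v ∈ A) : G.ConnIn A u v :=
  ⟨hu, .single ⟨h, hv⟩⟩

theorem trans (h : G.ConnIn A u v) (h' : G.ConnIn A v w) : G.ConnIn A u w :=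
  ⟨h.1, h.2.trans h'.2⟩

theorem symm (h : G.ConnIn A u v) : G.ConnIn A v u := by
  obtain ⟨hu, h⟩ := h
  induction h with
  | refl => exact refl hu
  | @tail b c hb hbc ih => exact (of_adj hbc.1.symm hbc.2 (ih.1)).trans ih

theorem mono (hG : G ≤ H) (hA : A ⊆ B) (h : G.ConnIn A u v) : H.ConnIn B u v :=
  ⟨hA h.1, Relation.ReflTransGen.mono (fun _ _ hxy => ⟨hG hxy.1, hA hxy.2⟩) _ _ h.2⟩

theorem joinedIn (E : PlaneEmbedding G) (h : G.ConnIn A u v) :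
    JoinedIn (E.subSupport A) (E.vtx u) (E.vtx v) := by
  obtain ⟨hu, h⟩ := h
  have mem : ∀ x ∈ A, E.vtx x ∈ E.subSupport A := fun x hx => .inl ⟨x, hx, rfl⟩
  have : v ∈ A ∧ JoinedIn (E.subSupport A) (E.vtx u) (E.vtx v) := by
    induction h with
    | refl => exact ⟨hu, .refl (mem u hu)⟩
    | @tail b c hb hbc ih =>
      refine ⟨hbc.2, ih.2.trans ?_⟩
      obtain ⟨γ, -, hγ⟩ := E.arc_path hbc.1
      refine ⟨γ, fun t => .inr ?_⟩
      simp only [Set.mem_iUnion]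
      exact ⟨b, ih.1, c, hbc.2, hbc.1, hγ ▸ ⟨t, rfl⟩⟩
  exact this.2

end SimpleGraph.ConnIn

section NonPlanarity

open SimpleGraph

theorem not_isPlanar_of_kFive {V : Type} {G : SimpleGraph V} (p : Fin 5 → V)
    (A : Fin 5 → Fin 5 → Set V)
    (hconn : ∀ a b, a < b → G.ConnIn (A a b) (p a) (p b))
    (hdisj : ∀ a b c d, a < b → c < d → a ≠ c → a ≠ d → b ≠ c → b ≠ d →
      Disjoint (A a b) (A c d)) : ¬ IsPlanar G := by
  rintro ⟨E⟩
  let e := Complex.equivRealProdCLM.symm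
  have hx : ∀ a b, ∃ g : C(unitInterval, ℂ), a < b → g 0 = e (E.vtx (p a)) ∧
      g 1 = e (E.vtx (p b)) ∧ ∀ t, ∃ q ∈ E.subSupport (A a b), g t = e q := by
    intro a b
    by_cases hab : a < b
    · obtain ⟨γ, hγ⟩ := (hconn a b hab).joinedIn E
      exact ⟨⟨fun t => e (γ t), by fun_prop⟩, fun _ => ⟨by simp, by simp, fun t => ⟨_, hγ t, rfl⟩⟩⟩
    · exact ⟨.const _ 0, fun h => absurd h hab⟩
  choose g hg using hx
  refine no_independent_disjoint_kFive (fun a => e (E.vtx (p a))) g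
    (fun a b hab => (hg a b hab).1) (fun a b hab => (hg a b hab).2.1) ?_
  intro a b c d hab hcd h1 h2 h3 h4 s t he
  obtain ⟨q, hq, hqs⟩ := (hg a b hab).2.2 s
  obtain ⟨r, hr, hrt⟩ := (hg c d hcd).2.2 t
  have hqr : q = r := e.injective (by rw [← hqs, ← hrt, he])
  exact Set.disjoint_left.1 (E.disjoint_subSupport (hdisj a b c d hab hcd h1 h2 h3 h4))
    hq (hqr ▸ hr)

theorem not_isPlanar_sup_edge_of_separated {V : Type} {G : SimpleGraph V} {u v x y z : V}
    {B W : Set V} (hBW : Disjoint B W) (hx : x ∈ W) (hy : y ∈ W) (hz : z ∈ W)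
    (hux : u ≠ x) (huy : u ≠ y) (huz : u ≠ z)
    (hxy : G.Adj x y) (hxz : G.Adj x z) (hyz : G.Adj y z)
    (hvx : G.ConnIn (B ∪ {x}) v x) (hvy : G.ConnIn (B ∪ {y}) v y) (hvz : G.ConnIn (B ∪ {z}) v z)
    (hu_x : G.ConnIn (W \ {y, z}) u x) (hu_y : G.ConnIn (W \ {x, z}) u y)
    (hu_z : G.ConnIn (W \ {x, y}) u z) (hv : v ∈ B) :
    ¬ IsPlanar (G ⊔ SimpleGraph.fromEdgeSet {s(u, v)}) := by
  rw [Set.disjoint_left] at hBW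
  have hu : u ∈ W := hu_x.1.1
  have huv : u ≠ v := fun h => hBW hv (h ▸ hu)
  refine not_isPlanar_of_kFive ![u, v, x, y, z]
    ![![∅, {u, v}, W \ {y, z}, W \ {x, z}, W \ {x, y}],
      ![∅, ∅, B ∪ {x}, B ∪ {y}, B ∪ {z}],
      ![∅, ∅, ∅, {x, y}, {x, z}], ![∅, ∅, ∅, ∅, {y, z}], ![∅, ∅, ∅, ∅, ∅]] ?_ ?_
  · have conv : ∀ {A : Set V} {a b : V}, G.ConnIn A a b →
        (G ⊔ SimpleGraph.fromEdgeSet {s(u, v)}).ConnIn A a b :=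
      fun h => h.mono le_sup_left subset_rfl
    intro a b hab
    fin_cases a <;> fin_cases b <;> first | exact absurd hab (by decide) | skip
    · exact ConnIn.of_adj (Or.inr (by simp [huv])) (by simp) (by simp)
    · exact conv hu_x
    · exact conv hu_y
    · exact conv hu_z
    · exact conv hvx
    · exact conv hvy
    · exact conv hvz
    · exact conv (ConnIn.of_adj hxy (by simp) (by simp))
    · exact conv (ConnIn.of_adj hxz (by simp) (by simp))
    · exact conv (ConnIn.of_adj hyz (by simp) (by simp))
  · have := hxy.ne
    have := hxz.ne
    have := hyz.ne
    intro a b c d hab hcd h1 h2 h3 h4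
    rw [Set.disjoint_left]
    intro q hq hq'
    fin_cases a <;> fin_cases b <;> first | exact absurd hab (by decide) | skip
    all_goals
      fin_cases c <;> first | exact absurd rfl h1 | exact absurd rfl h3 | skip
      all_goals
        fin_cases d <;>
          first | exact absurd hcd (by decide) | exact absurd rfl h2 | exact absurd rfl h4 | skip
      all_goals
        simp at hq hq'
        grind

theorem not_isPlanar_sup_edge_of_antipodal {V : Type} {G : SimpleGraph V} {u v x y w t : V}
    (hux : G.Adj u x) (huy : G.Adj u y) (huw : G.Adj u w)
    (hvx : G.Adj v x) (hvy : G.Adj v y) (hvw : G.Adj v w)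
    (hxy : G.Adj x y) (hxw : G.Adj x w) (hyt : G.Adj y t) (htw : G.Adj t w)
    (huv : u ≠ v) (hut : u ≠ t) (hvt : v ≠ t) (hxt : x ≠ t) (hyw : y ≠ w) :
    ¬ IsPlanar (G ⊔ SimpleGraph.fromEdgeSet {s(u, v)}) := by
  refine not_isPlanar_of_kFive ![u, v, x, y, w]
    ![![∅, {u, v}, {u, x}, {u, y}, {u, w}],
      ![∅, ∅, {v, x}, {v, y}, {v, w}],
      ![∅, ∅, ∅, {x, y}, {x, w}], ![∅, ∅, ∅, ∅, {y, t, w}], ![∅, ∅, ∅, ∅, ∅]] ?_ ?_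
  · have conv : ∀ {a b : V}, G.Adj a b →
        (G ⊔ SimpleGraph.fromEdgeSet {s(u, v)}).ConnIn {a, b} a b :=
      fun h => ConnIn.of_adj (Or.inl h) (by simp) (by simp)
    intro a b hab
    fin_cases a <;> fin_cases b <;> first | exact absurd hab (by decide) | skip
    · exact ConnIn.of_adj (Or.inr (by simp [huv])) (by simp) (by simp)
    · exact conv hux
    · exact conv huy
    · exact conv huw
    · exact conv hvx
    · exact conv hvy
    · exact conv hvw
    · exact conv hxy
    · exact conv hxw
    · exact (ConnIn.of_adj (v := t) (Or.inl hyt) (by simp) (by simp)).trans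
        (ConnIn.of_adj (Or.inl htw) (by simp) (by simp))
  · have := hux.ne
    have := huy.ne
    have := huw.ne
    have := hvx.ne
    have := hvy.ne
    have := hvw.ne
    have := hxy.ne
    have := hxw.ne
    have := hyt.ne
    have := htw.ne
    intro a b c d hab hcd h1 h2 h3 h4
    rw [Set.disjoint_left]
    intro q hq hq'
    fin_cases a <;> fin_cases b <;> first | exact absurd hab (by decide) | skip
    all_goals
      fin_cases c <;> first | exact absurd rfl h1 | exact absurd rfl h3 | skip
      all_goals
        fin_cases d <;>
          first | exact absurd hcd (by decide) | exact absurd rfl h2 | exact absurd rfl h4 | skip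
      all_goals
        simp at hq hq'
        grind

end NonPlanarity

/-- Three pairwise adjacent vertices of smaller rank, all of them adjacent to `v`. -/
def IsStacked {V : Type} (G : SimpleGraph V) (rank : V → ℕ) (v : V) : Prop :=
  ∃ x y z, (rank x < rank v ∧ rank y < rank v ∧ rank z < rank v) ∧
    (G.Adj x y ∧ G.Adj x z ∧ G.Adj y z) ∧ (G.Adj v x ∧ G.Adj v y ∧ G.Adj v z)

/-- `v` is one of three mutually adjacent vertices `v`, `w`, `t` of equal rank inserted
octahedrally into a triangle `x`, `y`, `z` of vertices of smaller rank. -/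
def IsOctahedral {V : Type} (G : SimpleGraph V) (rank : V → ℕ) (v : V) : Prop :=
  ∃ x y z w t, (rank x < rank v ∧ rank y < rank v ∧ rank z < rank v) ∧
    (rank w = rank v ∧ rank t = rank v) ∧
    (G.Adj x y ∧ G.Adj x z ∧ G.Adj y z) ∧ (G.Adj v x ∧ G.Adj v y) ∧
    (G.Adj w x ∧ G.Adj w z) ∧ (G.Adj t y ∧ G.Adj t z) ∧ (G.Adj v w ∧ G.Adj v t ∧ G.Adj t w)

section Maximality

variable {V : Type} {G : SimpleGraph V} {rank : V → ℕ}

theorem exists_connIn_rank_lt {b c v : V} (h : IsStacked G rank v ∨ IsOctahedral G rank v)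
    (hb : v ≠ b) (hc : v ≠ c) :
    ∃ q, rank q < rank v ∧ G.ConnIn ({p | rank p ≤ rank v} \ {b, c}) v q := by
  have direct : ∀ q, rank q < rank v → G.Adj v q → q ≠ b → q ≠ c →
      ∃ q, rank q < rank v ∧ G.ConnIn ({p | rank p ≤ rank v} \ {b, c}) v q :=
    fun q hq hvq hqb hqc => ⟨q, hq, .of_adj hvq (by simp [hb, hc]) (by simp [hq.le, hqb, hqc])⟩
  rcases h with ⟨x, y, z, ⟨rx, ry, rz⟩, ⟨xy, xz, yz⟩, vx, vy, vz⟩ |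
    ⟨x, y, z, w, t, ⟨rx, ry, rz⟩, ⟨rw', rt⟩, ⟨xy, xz, yz⟩, ⟨vx, vy⟩, ⟨wx, wz⟩, ⟨ty, tz⟩, vw, vt, tw⟩
  · have := xy.ne
    have := xz.ne
    have := yz.ne
    by_cases hx : x ≠ b ∧ x ≠ c
    · exact direct x rx vx hx.1 hx.2
    by_cases hy : y ≠ b ∧ y ≠ c
    · exact direct y ry vy hy.1 hy.2
    · exact direct z rz vz (by grind) (by grind)
  · have := xy.ne
    have := xz.ne
    have := yz.ne
    by_cases hx : x ≠ b ∧ x ≠ c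
    · exact direct x rx vx hx.1 hx.2
    by_cases hy : y ≠ b ∧ y ≠ c
    · exact direct y ry vy hy.1 hy.2
    have htx : t ≠ x := by rintro rfl; omega
    have hty : t ≠ y := ty.ne
    have hz : z ≠ b ∧ z ≠ c := by grind
    have ht : t ≠ b ∧ t ≠ c := by grind
    refine ⟨z, rz, SimpleGraph.ConnIn.trans (v := t) (.of_adj vt ?_ ?_) (.of_adj tz ?_ ?_)⟩ <;>
      simp [hb, hc, ht, hz, rt, rz.le]

theorem connIn_rank_lt (hbase : ∀ u v, rank u = rank v → u ≠ v → G.Adj u v)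
    (hstep : ∀ v, rank v ≠ 0 → IsStacked G rank v ∨ IsOctahedral G rank v)
    {u v b c : V} {r : ℕ} (hu : rank u < r) (hv : rank v < r)
    (hub : u ≠ b) (huc : u ≠ c) (hvb : v ≠ b) (hvc : v ≠ c) :
    G.ConnIn ({p | rank p < r} \ {b, c}) u v := by
  have descent : ∀ n w, rank w = n → rank w < r → w ≠ b → w ≠ c →
      ∃ q, rank q = 0 ∧ G.ConnIn ({p | rank p < r} \ {b, c}) w q := by
    intro n
    induction n using Nat.strong_induction_on with
    | _ n ih =>
      intro w hn hw hb hc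
      rcases eq_or_ne (rank w) 0 with h0 | h0
      · exact ⟨w, h0, .refl (by simp [hw, hb, hc])⟩
      · obtain ⟨q, hq, hwq⟩ := exists_connIn_rank_lt (hstep w h0) hb hc
        have hq' := hwq.right_mem.2
        simp only [Set.mem_insert_iff, Set.mem_singleton_iff, not_or] at hq'
        obtain ⟨s, hs, hqs⟩ := ih _ (hn ▸ hq) q rfl (hq.trans hw) hq'.1 hq'.2
        refine ⟨s, hs, (hwq.mono le_rfl ?_).trans hqs⟩
        exact Set.sdiff_subset_sdiff_left fun p hp => lt_of_le_of_lt hp hw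
  obtain ⟨s, hs, hus⟩ := descent _ u rfl hu hub huc
  obtain ⟨t, ht, hvt⟩ := descent _ v rfl hv hvb hvc
  refine hus.trans (.trans ?_ hvt.symm)
  rcases eq_or_ne s t with rfl | hst
  · exact .refl hus.right_mem
  · exact .of_adj (hbase s t (hs.trans ht.symm) hst) hus.right_mem hvt.right_mem

/-- A graph built from a clique by inserting single vertices and octahedral triples
into triangles is edge-maximal planar as soon as it is planar. -/
theorem not_isPlanar_sup_edge_of_rank (hbase : ∀ u v, rank u = rank v → u ≠ v → G.Adj u v)
    (hstep : ∀ v, rank v ≠ 0 → IsStacked G rank v ∨ IsOctahedral G rank v)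
    (u v : V) (huv : u ≠ v) (hadj : ¬ G.Adj u v) :
    ¬ IsPlanar (G ⊔ SimpleGraph.fromEdgeSet {s(u, v)}) := by
  wlog hlt : rank u < rank v generalizing u v
  · rw [Sym2.eq_swap]
    exact this v u huv.symm (fun h => hadj h.symm)
      (lt_of_le_of_ne (not_lt.1 hlt) fun h => hadj (hbase u v h.symm huv))
  have sep : ∀ x y z, rank x < rank v → rank y < rank v → rank z < rank v →
      G.Adj x y → G.Adj x z → G.Adj y z → u ≠ x → u ≠ y → u ≠ z →
      (∀ q, q = x ∨ q = y ∨ q = z → G.ConnIn ({p | rank p = rank v} ∪ {q}) v q) →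
      ¬ IsPlanar (G ⊔ SimpleGraph.fromEdgeSet {s(u, v)}) := by
    intro x y z rx ry rz xy xz yz ux uy uz hv
    refine not_isPlanar_sup_edge_of_separated (B := {p | rank p = rank v})
      (W := {p | rank p < rank v}) ?_ rx ry rz ux uy uz xy xz yz
      (hv x (by simp)) (hv y (by simp)) (hv z (by simp)) ?_ ?_ ?_ rfl
    · rw [Set.disjoint_left]
      intro p hp hp'
      exact hp'.ne hp
    · exact connIn_rank_lt hbase hstep hlt rx uy uz xy.ne xz.ne
    · exact connIn_rank_lt hbase hstep hlt ry ux uz xy.ne' yz.ne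
    · exact connIn_rank_lt hbase hstep hlt rz ux uy xz.ne' yz.ne'
  rcases hstep v (by omega) with ⟨x, y, z, ⟨rx, ry, rz⟩, ⟨xy, xz, yz⟩, vx, vy, vz⟩ |
    ⟨x, y, z, w, t, ⟨rx, ry, rz⟩, ⟨rw', rt⟩, ⟨xy, xz, yz⟩, ⟨vx, vy⟩, ⟨wx, wz⟩, ⟨ty, tz⟩, vw, vt, tw⟩
  · refine sep x y z rx ry rz xy xz yz ?_ ?_ ?_ ?_
    · rintro rfl; exact hadj vx.symm
    · rintro rfl; exact hadj vy.symm
    · rintro rfl; exact hadj vz.symm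
    · rintro q (rfl | rfl | rfl) <;> refine .of_adj ?_ (by simp) (by simp) <;> assumption
  · rcases eq_or_ne u z with rfl | uz
    · exact not_isPlanar_sup_edge_of_antipodal (x := x) (y := y) (w := w) (t := t)
        xz.symm yz.symm wz.symm vx vy vw xy wx.symm ty.symm tw huv tz.ne' vt.ne
        (by rintro rfl; omega) (by rintro rfl; omega)
    · refine sep x y z rx ry rz xy xz yz ?_ ?_ uz ?_
      · rintro rfl; exact hadj vx.symm
      · rintro rfl; exact hadj vy.symm
      · rintro q (rfl | rfl | rfl)
        · exact .of_adj vx (by simp) (by simp)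
        · exact .of_adj vy (by simp) (by simp)
        · exact SimpleGraph.ConnIn.trans (v := w) (.of_adj vw (by simp) (by simp [rw']))
            (.of_adj wz (by simp [rw']) (by simp))

end Maximality

/-- The edges of one level of the nested triangulation: a triangle `0, 1, 2` with centre `3`,
and in each of the three inner faces two octahedral insertions. -/
def cellEdges : List (Fin 22 × Fin 22) :=
  [(0, 1), (0, 2), (1, 2), (0, 3), (1, 3), (2, 3),
   (0, 4), (1, 4), (1, 5), (3, 5), (0, 6), (3, 6), (4, 5), (4, 6), (5, 6),
   (4, 7), (5, 7), (5, 8), (6, 8), (4, 9), (6, 9), (7, 8), (7, 9), (8, 9),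
   (0, 10), (2, 10), (2, 11), (3, 11), (0, 12), (3, 12), (10, 11), (10, 12), (11, 12),
   (10, 13), (11, 13), (11, 14), (12, 14), (10, 15), (12, 15), (13, 14), (13, 15), (14, 15),
   (1, 16), (2, 16), (2, 17), (3, 17), (1, 18), (3, 18), (16, 17), (16, 18), (17, 18),
   (16, 19), (17, 19), (17, 20), (18, 20), (16, 21), (18, 21), (19, 20), (19, 21), (20, 21)]

/-- The edges from the face `0, 4, 6` of a level to the triangle `0, 1, 2` of the next one. -/
def linkEdges : List (Fin 22 × Fin 22) :=
  [(0, 0), (0, 2), (4, 0), (4, 1), (6, 1), (6, 2)]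

/-- Adjacency within one level. -/
def CellAdj (u v : Fin 22) : Prop := (u, v) ∈ cellEdges ∨ (v, u) ∈ cellEdges

instance : DecidableRel CellAdj := fun u v =>
  inferInstanceAs (Decidable ((u, v) ∈ cellEdges ∨ (v, u) ∈ cellEdges))

theorem CellAdj.symm {u v : Fin 22} (h : CellAdj u v) : CellAdj v u := Or.symm h

theorem not_cellAdj_self : ∀ u, ¬ CellAdj u u := by decide +kernel

/-- The nested triangulation with `k` levels; level `0` is the outermost one. -/
def nested (k : ℕ) : SimpleGraph (Fin k × Fin 22) where
  Adj p q := (p.1 = q.1 ∧ CellAdj p.2 q.2) ∨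
    ((p.1 : ℕ) + 1 = q.1 ∧ (p.2, q.2) ∈ linkEdges) ∨
    ((q.1 : ℕ) + 1 = p.1 ∧ (q.2, p.2) ∈ linkEdges)
  symm := ⟨by
    rintro p q (⟨h, h'⟩ | h | h)
    · exact .inl ⟨h.symm, h'.symm⟩
    · exact .inr (.inr h)
    · exact .inr (.inl h)⟩
  loopless := ⟨by
    rintro ⟨i, u⟩ (⟨-, h⟩ | ⟨h, -⟩ | ⟨h, -⟩)
    · exact not_cellAdj_self u h
    · simp at h
    · simp at h⟩

/-- The step at which a vertex is inserted within its level. -/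
def cellRank : Fin 22 → ℕ :=
  ![0, 0, 0, 1, 2, 2, 2, 3, 3, 3, 4, 4, 4, 5, 5, 5, 6, 6, 6, 7, 7, 7]

/-- The step at which a vertex of the nested triangulation is inserted. -/
def nestedRank {k : ℕ} (p : Fin k × Fin 22) : ℕ := 8 * p.1 + cellRank p.2

theorem cellRank_lt : ∀ v, cellRank v < 8 := by decide +kernel

theorem cellAdj_of_cellRank_eq : ∀ u v, cellRank u = cellRank v → u ≠ v → CellAdj u v := by
  decide +kernel

theorem cell_octahedral : ∀ v : Fin 22, 4 ≤ v →
    ∃ x, (cellRank x < cellRank v ∧ CellAdj v x) ∧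
    ∃ y, (cellRank y < cellRank v ∧ CellAdj v y ∧ CellAdj x y) ∧
    ∃ z, (cellRank z < cellRank v ∧ CellAdj x z ∧ CellAdj y z) ∧
    ∃ w, (cellRank w = cellRank v ∧ CellAdj v w ∧ CellAdj w x ∧ CellAdj w z) ∧
    ∃ t, cellRank t = cellRank v ∧ CellAdj v t ∧ CellAdj t w ∧ CellAdj t y ∧ CellAdj t z := by
  decide +kernel

theorem nested_adj_of_rank_eq {k : ℕ} (u v : Fin k × Fin 22) (h : nestedRank u = nestedRank v)
    (huv : u ≠ v) : (nested k).Adj u v := by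
  obtain ⟨i, u⟩ := u
  obtain ⟨j, v⟩ := v
  have hu := cellRank_lt u
  have hv := cellRank_lt v
  simp only [nestedRank] at h
  have hij : i = j := by ext; omega
  subst hij
  exact .inl ⟨rfl, cellAdj_of_cellRank_eq u v (by omega) (by simpa using huv)⟩

theorem nested_step {k : ℕ} (p : Fin k × Fin 22) (hp : nestedRank p ≠ 0) :
    IsStacked (nested k) nestedRank p ∨ IsOctahedral (nested k) nestedRank p := by
  obtain ⟨i, v⟩ := p
  by_cases hv : 4 ≤ v
  · obtain ⟨x, ⟨rx, vx⟩, y, ⟨ry, vy, xy⟩, z, ⟨rz, xz, yz⟩, w, ⟨rw', vw, wx, wz⟩, t, rt, vt, tw,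
      ty, tz⟩ := cell_octahedral v hv
    refine .inr ⟨(i, x), (i, y), (i, z), (i, w), (i, t), ⟨?_, ?_, ?_⟩, ⟨?_, ?_⟩,
      ⟨.inl ⟨rfl, xy⟩, .inl ⟨rfl, xz⟩, .inl ⟨rfl, yz⟩⟩, ⟨.inl ⟨rfl, vx⟩, .inl ⟨rfl, vy⟩⟩,
      ⟨.inl ⟨rfl, wx⟩, .inl ⟨rfl, wz⟩⟩, ⟨.inl ⟨rfl, ty⟩, .inl ⟨rfl, tz⟩⟩,
      ⟨.inl ⟨rfl, vw⟩, .inl ⟨rfl, vt⟩, .inl ⟨rfl, tw⟩⟩⟩ <;> simpa [nestedRank]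
  · rcases eq_or_ne v 3 with rfl | hv3
    · refine .inl ⟨(i, 0), (i, 1), (i, 2), ⟨?_, ?_, ?_⟩, ⟨?_, ?_, ?_⟩, ?_, ?_, ?_⟩
      iterate 3 · simp [nestedRank, cellRank]
      all_goals exact .inl ⟨rfl, by dsimp only; decide +kernel⟩
    · have hv : v = 0 ∨ v = 1 ∨ v = 2 := by omega
      have hr : cellRank v = 0 := by rcases hv with rfl | rfl | rfl <;> rfl
      obtain ⟨i, hi⟩ := i
      obtain ⟨j, rfl⟩ : ∃ j, i = j + 1 :=
        Nat.exists_eq_succ_of_ne_zero (by rintro rfl; exact hp (by simp [nestedRank, hr]))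
      let o (u : Fin 22) : Fin k × Fin 22 := (⟨j, by omega⟩, u)
      let n (u : Fin 22) : Fin k × Fin 22 := (⟨j + 1, hi⟩, u)
      have ho : ∀ u, nestedRank (o u) < nestedRank (n v) := fun u => by
        have := cellRank_lt u
        simp only [nestedRank, o, n]
        omega
      have hnn : ∀ u, cellRank u = 0 → nestedRank (n u) = nestedRank (n v) := fun u hu => by
        simp [nestedRank, n, hr, hu]
      have hl : ∀ a b, (a, b) ∈ linkEdges → (nested k).Adj (n b) (o a) :=
        fun a b h => .inr (.inr ⟨rfl, h⟩)
      have hoo : ∀ a b, CellAdj a b → (nested k).Adj (o a) (o b) := fun a b h => .inl ⟨rfl, h⟩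
      have hn' : ∀ a b, CellAdj a b → (nested k).Adj (n a) (n b) := fun a b h => .inl ⟨rfl, h⟩
      have build : ∀ x y z w t, cellRank w = 0 → cellRank t = 0 →
          CellAdj x y ∧ CellAdj x z ∧ CellAdj y z ∧ (x, v) ∈ linkEdges ∧ (y, v) ∈ linkEdges ∧
            (x, w) ∈ linkEdges ∧ (z, w) ∈ linkEdges ∧ (y, t) ∈ linkEdges ∧ (z, t) ∈ linkEdges ∧
            CellAdj v w ∧ CellAdj v t ∧ CellAdj t w →
          IsOctahedral (nested k) nestedRank (n v) := by
        rintro x y z w t rw' rt ⟨xy, xz, yz, vx, vy, wx, wz, ty, tz, vw, vt, tw⟩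
        exact ⟨o x, o y, o z, n w, n t, ⟨ho x, ho y, ho z⟩, ⟨hnn w rw', hnn t rt⟩,
          ⟨hoo _ _ xy, hoo _ _ xz, hoo _ _ yz⟩, ⟨hl _ _ vx, hl _ _ vy⟩, ⟨hl _ _ wx, hl _ _ wz⟩,
          ⟨hl _ _ ty, hl _ _ tz⟩, hn' _ _ vw, hn' _ _ vt, hn' _ _ tw⟩
      right
      rcases hv with rfl | rfl | rfl
      · exact build 0 4 6 2 1 rfl rfl (by decide +kernel)
      · exact build 4 6 0 0 2 rfl rfl (by decide +kernel)
      · exact build 0 6 4 0 1 rfl rfl (by decide +kernel)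

section Segments

/-- Twice the signed area of the triangle `P`, `Q`, `X`. -/
def orient {R : Type} [CommRing R] (P Q X : R × R) : R :=
  (Q.1 - P.1) * (X.2 - P.2) - (Q.2 - P.2) * (X.1 - P.1)

/-- The segments `P Q` and `R S` meet only in common endpoints. -/
def SegCompat (P Q R S : ℝ × ℝ) : Prop :=
  segment ℝ P Q ∩ segment ℝ R S ⊆ {P, Q} ∩ {R, S}

variable {P Q R S X : ℝ × ℝ}

theorem SegCompat.swap_left (h : SegCompat P Q R S) : SegCompat Q P R S := by
  rwa [SegCompat, segment_symm, Set.pair_comm Q P]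

theorem SegCompat.symm (h : SegCompat P Q R S) : SegCompat R S P Q := by
  rwa [SegCompat, Set.inter_comm, Set.inter_comm {R, S}]

theorem SegCompat.swap_right (h : SegCompat P Q R S) : SegCompat P Q S R :=
  h.symm.swap_left.symm

theorem exists_orient_eq_of_mem_segment (h : X ∈ segment ℝ R S) :
    ∃ t : ℝ, 0 ≤ t ∧ t ≤ 1 ∧ X = ((1 - t) * R.1 + t * S.1, (1 - t) * R.2 + t * S.2) ∧
      ∀ P Q, orient P Q X = (1 - t) * orient P Q R + t * orient P Q S := by
  obtain ⟨a, t, ha, ht, hat, rfl⟩ := h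
  obtain rfl : a = 1 - t := by linarith
  refine ⟨t, ht, by linarith, by ext <;> simp, fun P Q => ?_⟩
  simp only [orient, Prod.fst_add, Prod.snd_add, Prod.smul_fst, Prod.smul_snd, smul_eq_mul]
  ring

theorem orient_eq_zero_of_mem_segment (h : X ∈ segment ℝ P Q) : orient P Q X = 0 := by
  obtain ⟨t, -, -, -, h⟩ := exists_orient_eq_of_mem_segment h
  rw [h]
  simp only [orient]
  ring

theorem orient_pos_of_mem_segment (hR : 0 < orient P Q R) (hS : 0 < orient P Q S)
    (h : X ∈ segment ℝ R S) : 0 < orient P Q X := by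
  obtain ⟨t, h0, h1, -, h⟩ := exists_orient_eq_of_mem_segment h
  rw [h]
  rcases h0.eq_or_lt with rfl | h0
  · simpa
  · nlinarith [mul_nonneg (sub_nonneg.2 h1) hR.le, mul_pos h0 hS]

theorem orient_nonpos_of_mem_segment (hR : orient P Q R ≤ 0) (hS : orient P Q S ≤ 0)
    (h : X ∈ segment ℝ R S) : orient P Q X ≤ 0 := by
  obtain ⟨t, h0, h1, -, h⟩ := exists_orient_eq_of_mem_segment h
  rw [h]
  nlinarith [mul_nonneg (sub_nonneg.2 h1) (neg_nonneg.2 hR), mul_nonneg h0 (neg_nonneg.2 hS)]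

theorem segCompat_of_separated {A B : ℝ × ℝ} (hP : orient A B P ≤ 0) (hQ : orient A B Q ≤ 0)
    (hR : 0 < orient A B R) (hS : 0 < orient A B S) : SegCompat P Q R S := fun _ hX =>
  absurd (orient_nonpos_of_mem_segment hP hQ hX.1) (orient_pos_of_mem_segment hR hS hX.2).not_ge

theorem segCompat_of_orient_mul_pos (h : 0 < orient P Q R * orient P Q S) :
    SegCompat P Q R S := by
  intro X hX
  exfalso
  have h0 := orient_eq_zero_of_mem_segment hX.1
  obtain ⟨t, ht0, ht1, -, ht⟩ := exists_orient_eq_of_mem_segment hX.2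
  rw [ht] at h0
  rcases mul_pos_iff.1 h with ⟨hR, hS⟩ | ⟨hR, hS⟩
  · rcases ht0.eq_or_lt with rfl | ht0
    · linarith
    · nlinarith [mul_nonneg (sub_nonneg.2 ht1) hR.le, mul_pos ht0 hS]
  · rcases ht0.eq_or_lt with rfl | ht0
    · linarith
    · nlinarith [mul_nonneg (sub_nonneg.2 ht1) (neg_pos.2 hR).le, mul_pos ht0 (neg_pos.2 hS)]

theorem segCompat_of_common (h : orient P Q S ≠ 0) : SegCompat P Q P S := by
  intro X hX
  have h0 := orient_eq_zero_of_mem_segment hX.1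
  obtain ⟨t, -, -, hX', ht⟩ := exists_orient_eq_of_mem_segment hX.2
  rw [ht] at h0
  have hP : orient P Q P = 0 := by simp only [orient]; ring
  rw [hP, mul_zero, zero_add, mul_eq_zero, or_iff_left h] at h0
  subst h0
  simp [hX']

theorem segCompat_of_obtuse
    (h : (P.1 - Q.1) * (S.1 - Q.1) + (P.2 - Q.2) * (S.2 - Q.2) < 0) : SegCompat P Q Q S := by
  intro X hX
  obtain ⟨s, -, hs1, hX1, -⟩ := exists_orient_eq_of_mem_segment hX.1
  obtain ⟨t, ht0, -, hX2, -⟩ := exists_orient_eq_of_mem_segment hX.2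
  have e1 := congrArg Prod.fst (hX1.symm.trans hX2)
  have e2 := congrArg Prod.snd (hX1.symm.trans hX2)
  simp only at e1 e2
  have key : (1 - s) * ((P.1 - Q.1) ^ 2 + (P.2 - Q.2) ^ 2) =
      t * ((P.1 - Q.1) * (S.1 - Q.1) + (P.2 - Q.2) * (S.2 - Q.2)) := by
    linear_combination (P.1 - Q.1) * e1 + (P.2 - Q.2) * e2
  have ht : t = 0 := by
    by_contra hne
    have := mul_pos (lt_of_le_of_ne ht0 (Ne.symm hne)) (neg_pos.2 h)
    have := mul_nonneg (sub_nonneg.2 hs1)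
      (add_nonneg (sq_nonneg (P.1 - Q.1)) (sq_nonneg (P.2 - Q.2)))
    linarith
  subst ht
  simp [hX2]

/-- A straight-line drawing in which edges meet only in common endpoints. -/
def PlaneEmbedding.ofSegments {V : Type} {G : SimpleGraph V} (pos : V → ℝ × ℝ)
    (hinj : Function.Injective pos)
    (hvtx : ∀ ⦃u v : V⦄, G.Adj u v → ∀ w, pos w ∈ segment ℝ (pos u) (pos v) → w = u ∨ w = v)
    (hinter : ∀ ⦃u v a b : V⦄, G.Adj u v → G.Adj a b → s(u, v) ≠ s(a, b) →
      SegCompat (pos u) (pos v) (pos a) (pos b)) : PlaneEmbedding G where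
  vtx := pos
  vtx_inj := hinj
  arc u v _ := segment ℝ (pos u) (pos v)
  arc_symm u v _ := segment_symm ℝ _ _
  arc_path u v h := by
    have hne : pos u ≠ pos v := hinj.ne h.ne
    refine ⟨⟨⟨fun t => AffineMap.lineMap (pos u) (pos v) (t : ℝ), by fun_prop⟩, by simp, by simp⟩,
      ?_, ?_⟩
    · intro s t hst
      exact Subtype.ext (AffineMap.lineMap_injective ℝ hne hst)
    · rw [segment_eq_image_lineMap]
      ext X
      simp only [Set.mem_range, Set.mem_image]
      exact ⟨fun ⟨t, ht⟩ => ⟨t, t.2, ht⟩, fun ⟨t, ht, hX⟩ => ⟨⟨t, ht⟩, hX⟩⟩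
  arc_vtx u v h w hw := hvtx h w hw
  arc_inter u v a b h₁ h₂ hne := hinter h₁ h₂ hne

/-- An exact test for two segments with integer endpoints. -/
def SegTest (A B C D : ℤ × ℤ) : Prop :=
  (0 < orient A B C * orient A B D ∨ 0 < orient C D A * orient C D B) ∨
  ((A = C ∨ B = C) ∧ orient A B D ≠ 0) ∨ ((A = D ∨ B = D) ∧ orient A B C ≠ 0) ∨
  (B = C ∧ (A.1 - B.1) * (D.1 - B.1) + (A.2 - B.2) * (D.2 - B.2) < 0)

instance (A B C D : ℤ × ℤ) : Decidable (SegTest A B C D) :=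
  inferInstanceAs (Decidable (
    (0 < orient A B C * orient A B D ∨ 0 < orient C D A * orient C D B) ∨
    ((A = C ∨ B = C) ∧ orient A B D ≠ 0) ∨ ((A = D ∨ B = D) ∧ orient A B C ≠ 0) ∨
    (B = C ∧ (A.1 - B.1) * (D.1 - B.1) + (A.2 - B.2) * (D.2 - B.2) < 0)))

/-- The real point `r • A`. -/
def scaled (r : ℝ) (A : ℤ × ℤ) : ℝ × ℝ := (r * A.1, r * A.2)

theorem orient_scaled (r : ℝ) (A B C : ℤ × ℤ) :
    orient (scaled r A) (scaled r B) (scaled r C) = r ^ 2 * (orient A B C : ℤ) := by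
  simp only [orient, scaled]
  push_cast
  ring

theorem SegTest.segCompat {A B C D : ℤ × ℤ} (h : SegTest A B C D) {r : ℝ} (hr : 0 < r) :
    SegCompat (scaled r A) (scaled r B) (scaled r C) (scaled r D) := by
  have mul : ∀ A B C D : ℤ × ℤ, 0 < orient A B C * orient A B D →
      SegCompat (scaled r A) (scaled r B) (scaled r C) (scaled r D) := by
    intro A B C D h
    apply segCompat_of_orient_mul_pos
    rw [orient_scaled, orient_scaled, mul_mul_mul_comm, ← Int.cast_mul]
    have : (0 : ℝ) < ((orient A B C * orient A B D : ℤ) : ℝ) := by exact_mod_cast h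
    positivity
  have ne : ∀ A B C : ℤ × ℤ, orient A B C ≠ 0 →
      orient (scaled r A) (scaled r B) (scaled r C) ≠ 0 := by
    intro A B C h
    rw [orient_scaled]
    have : ((orient A B C : ℤ) : ℝ) ≠ 0 := by exact_mod_cast h
    positivity
  have swap : ∀ A B C : ℤ × ℤ, orient A B C ≠ 0 → orient B A C ≠ 0 := by
    intro A B C h h'
    apply h
    simp only [orient] at h' ⊢
    linarith
  rcases h with (h | h) | ⟨rfl | rfl, h⟩ | ⟨rfl | rfl, h⟩ | ⟨rfl, h⟩
  · exact mul _ _ _ _ h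
  · exact (mul _ _ _ _ h).symm
  · exact segCompat_of_common (ne _ _ _ h)
  · exact (segCompat_of_common (ne _ _ _ (swap _ _ _ h))).swap_left
  · exact (segCompat_of_common (ne _ _ _ h)).swap_right
  · exact (segCompat_of_common (ne _ _ _ (swap _ _ _ h))).swap_left.swap_right
  · apply segCompat_of_obtuse
    simp only [scaled]
    have h' : (((A.1 - B.1) * (D.1 - B.1) + (A.2 - B.2) * (D.2 - B.2) : ℤ) : ℝ) < 0 := by
      exact_mod_cast h
    push_cast at h'
    nlinarith [mul_pos (pow_pos hr 2) (neg_pos.2 h')]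

end Segments

/-- Coordinates of the vertices of one level. -/
def cellPos : Fin 22 → ℤ × ℤ :=
  ![(45, 146), (-135, -214), (225, -214), (90, -124), (-30, -44), (-15, -134), (45, -14),
    (-9, -74), (6, -68), (3, -50), (130, -44), (145, -134), (85, -14), (127, -74), (118, -68),
    (115, -50), (50, -204), (125, -174), (5, -174), (71, -186), (62, -180), (47, -186)]

/-- The coordinates of level `i`, shrunk by the factor `20` from each level to the next. -/
noncomputable def nestedPos (i : ℕ) (v : Fin 22) : ℝ × ℝ := scaled ((1 / 20) ^ i) (cellPos v)

/-- The coordinates of level `n` relative to the grid of level `m`. -/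
def gridPos (m n : ℕ) (v : Fin 22) : ℤ × ℤ :=
  (20 ^ (m - n) * (cellPos v).1, 20 ^ (m - n) * (cellPos v).2)

theorem nestedPos_eq_scaled {i m n : ℕ} (h : n ≤ m) (v : Fin 22) :
    nestedPos (i + n) v = scaled ((1 / 20) ^ (i + m)) (gridPos m n v) := by
  obtain ⟨d, rfl⟩ := Nat.exists_eq_add_of_le h
  have : ((1 : ℝ) / 20) ^ (i + n) = (1 / 20) ^ (i + (n + d)) * 20 ^ d := by
    rw [← add_assoc, pow_add _ (i + n) d, mul_assoc, ← mul_pow]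
    norm_num
  simp only [nestedPos, scaled, gridPos, this, Nat.add_sub_cancel_left]
  push_cast
  simp only [mul_assoc]

/-- The edges inside a level and from it to the next, with relative levels. -/
def stepEdges : List ((ℕ × Fin 22) × (ℕ × Fin 22)) :=
  cellEdges.map (fun e => ((0, e.1), (0, e.2))) ++ linkEdges.map (fun e => ((0, e.1), (1, e.2)))

theorem stepEdges_level : ∀ e ∈ stepEdges, e.1.1 ≤ 1 ∧ e.2.1 ≤ 1 := by decide +kernel

theorem stepEdges_segTest : ∀ e ∈ stepEdges, ∀ f ∈ stepEdges,
    (e ≠ f → SegTest (gridPos 1 e.1.1 e.1.2) (gridPos 1 e.2.1 e.2.2)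
      (gridPos 1 f.1.1 f.1.2) (gridPos 1 f.2.1 f.2.2)) ∧
    SegTest (gridPos 2 e.1.1 e.1.2) (gridPos 2 e.2.1 e.2.2)
      (gridPos 2 (1 + f.1.1) f.1.2) (gridPos 2 (1 + f.2.1) f.2.2) := by
  decide +kernel

theorem stepEdges_outside : ∀ e ∈ stepEdges, ∃ m : Fin 3,
    orient (cellPos (![0, 1, 2] m)) (cellPos (![1, 2, 0] m)) (gridPos 1 e.1.1 e.1.2) ≤ 0 ∧
    orient (cellPos (![0, 1, 2] m)) (cellPos (![1, 2, 0] m)) (gridPos 1 e.2.1 e.2.2) ≤ 0 := by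
  decide +kernel

theorem cellPos_inside : ∀ m : Fin 3,
    0 < orient (cellPos (![0, 1, 2] m)) (cellPos (![1, 2, 0] m)) 0 ∧
    ∀ v, 0 ≤ orient (cellPos (![0, 1, 2] m)) (cellPos (![1, 2, 0] m)) (cellPos v) := by
  decide +kernel

theorem cellPos_not_dvd : ∀ v, ¬ ((20 : ℤ) ∣ (cellPos v).1 ∧ (20 : ℤ) ∣ (cellPos v).2) := by
  decide +kernel

theorem cellPos_injective : Function.Injective cellPos := by decide +kernel

theorem scaled_injective {r : ℝ} (hr : r ≠ 0) : Function.Injective (scaled r) := by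
  intro A B h
  simpa [scaled, hr, Prod.ext_iff] using h

theorem nestedPos_injective : Function.Injective (fun p : ℕ × Fin 22 => nestedPos p.1 p.2) := by
  rintro ⟨i, u⟩ ⟨j, v⟩ h
  dsimp only at h
  wlog hij : i ≤ j generalizing i j u v
  · exact (this j v i u h.symm (le_of_not_ge hij)).symm
  obtain ⟨d, rfl⟩ := Nat.exists_eq_add_of_le hij
  have h' : gridPos d 0 u = gridPos d d v := by
    apply scaled_injective (r := (1 / 20) ^ (i + d)) (by positivity)
    rw [← nestedPos_eq_scaled (Nat.zero_le d), ← nestedPos_eq_scaled le_rfl]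
    simpa using h
  rcases d with _ | d
  · simpa using cellPos_injective (by simpa [gridPos, Prod.ext_iff] using h')
  · refine absurd ?_ (cellPos_not_dvd v)
    simp only [gridPos, Prod.mk.injEq, Nat.sub_zero, Nat.sub_self, pow_zero, one_mul] at h'
    rw [← h'.1, ← h'.2, pow_succ']
    exact ⟨⟨20 ^ d * (cellPos u).1, by ring⟩, ⟨20 ^ d * (cellPos u).2, by ring⟩⟩

theorem orient_nestedPos_pos (m : Fin 3) {i j : ℕ} (hij : i < j) (v : Fin 22) :
    0 < orient (nestedPos i (![0, 1, 2] m)) (nestedPos i (![1, 2, 0] m)) (nestedPos j v) := by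
  obtain ⟨d, rfl⟩ := Nat.exists_eq_add_of_lt hij
  obtain ⟨h0, hv⟩ := cellPos_inside m
  specialize hv v
  generalize hA : cellPos (![0, 1, 2] m) = A at h0 hv
  generalize hB : cellPos (![1, 2, 0] m) = B at h0 hv
  have h0 : (0 : ℝ) < ((orient A B 0 : ℤ) : ℝ) := by exact_mod_cast h0
  have hv : (0 : ℝ) ≤ ((orient A B (cellPos v) : ℤ) : ℝ) := by exact_mod_cast hv
  set r : ℝ := (1 / 20) ^ i with hr
  set t : ℝ := (1 / 20) ^ (d + 1) with ht
  have hr0 : 0 < r := by positivity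
  have ht0 : 0 < t := by positivity
  have ht1 : t < 1 := pow_lt_one₀ (by norm_num) (by norm_num) (by omega)
  have key : orient (nestedPos i (![0, 1, 2] m)) (nestedPos i (![1, 2, 0] m))
      (nestedPos (i + d + 1) v) = r ^ 2 * ((1 - t) * ((orient A B 0 : ℤ) : ℝ) +
        t * ((orient A B (cellPos v) : ℤ) : ℝ)) := by
    have hrt : ((1 : ℝ) / 20) ^ (i + d + 1) = r * t := by rw [hr, ht, ← pow_add, add_assoc]
    simp only [nestedPos, orient, scaled, hA, hB, hrt, ← hr]
    push_cast
    simp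
    ring
  rw [key]
  have := mul_pos (sub_pos.2 ht1) h0
  have := mul_nonneg ht0.le hv
  positivity

/-- The position of a vertex of the relative level `x.1` above level `i`. -/
noncomputable def shiftPos (i : ℕ) (x : ℕ × Fin 22) : ℝ × ℝ := nestedPos (i + x.1) x.2

theorem stepEdges_segCompat {e f : (ℕ × Fin 22) × (ℕ × Fin 22)} (he : e ∈ stepEdges)
    (hf : f ∈ stepEdges) (i j : ℕ) (hne : ¬ (i = j ∧ e = f)) :
    SegCompat (shiftPos i e.1) (shiftPos i e.2) (shiftPos j f.1) (shiftPos j f.2) := by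
  wlog hij : i ≤ j generalizing i j e f
  · exact (this hf he j i (fun h => hne ⟨h.1.symm, h.2.symm⟩) (le_of_not_ge hij)).symm
  have le := stepEdges_level e he
  have lf := stepEdges_level f hf
  obtain ⟨h1, h2⟩ := stepEdges_segTest e he f hf
  have hr : ∀ n : ℕ, (0 : ℝ) < (1 / 20) ^ n := fun n => by positivity
  rcases hij.eq_or_lt with rfl | hlt
  · have := (h1 fun h => hne ⟨rfl, h⟩).segCompat (hr (i + 1))
    rwa [← nestedPos_eq_scaled le.1, ← nestedPos_eq_scaled le.2, ← nestedPos_eq_scaled lf.1,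
      ← nestedPos_eq_scaled lf.2] at this
  rcases (Nat.succ_le_of_lt hlt).eq_or_lt with rfl | hlt
  · have := h2.segCompat (hr (i + 2))
    rw [← nestedPos_eq_scaled (by omega), ← nestedPos_eq_scaled (by omega),
      ← nestedPos_eq_scaled (by omega), ← nestedPos_eq_scaled (by omega)] at this
    simpa only [shiftPos, add_assoc, Nat.succ_eq_add_one] using this
  · obtain ⟨m, hm1, hm2⟩ := stepEdges_outside e he
    have out : ∀ x : ℕ × Fin 22, x.1 ≤ 1 →
        orient (cellPos (![0, 1, 2] m)) (cellPos (![1, 2, 0] m)) (gridPos 1 x.1 x.2) ≤ 0 →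
        orient (nestedPos (i + 1) (![0, 1, 2] m)) (nestedPos (i + 1) (![1, 2, 0] m))
          (shiftPos i x) ≤ 0 := by
      intro x hx h
      rw [shiftPos, nestedPos_eq_scaled hx, nestedPos, nestedPos, orient_scaled]
      exact mul_nonpos_of_nonneg_of_nonpos (by positivity) (by exact_mod_cast h)
    exact segCompat_of_separated (out _ le.1 hm1) (out _ le.2 hm2)
      (orient_nestedPos_pos m (by omega) _) (orient_nestedPos_pos m (by omega) _)

theorem nested_adj_exists {k : ℕ} {p q : Fin k × Fin 22} (h : (nested k).Adj p q) :
    ∃ i : ℕ, ∃ e ∈ stepEdges,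
      (((p.1 : ℕ), p.2) = (i + e.1.1, e.1.2) ∧ ((q.1 : ℕ), q.2) = (i + e.2.1, e.2.2)) ∨
      (((q.1 : ℕ), q.2) = (i + e.1.1, e.1.2) ∧ ((p.1 : ℕ), p.2) = (i + e.2.1, e.2.2)) := by
  obtain ⟨i, u⟩ := p
  obtain ⟨j, v⟩ := q
  have cell : ∀ u v, (u, v) ∈ cellEdges → (((0 : ℕ), u), ((0 : ℕ), v)) ∈ stepEdges := fun u v h =>
    List.mem_append_left _ (List.mem_map.2 ⟨_, h, rfl⟩)
  have link : ∀ u v, (u, v) ∈ linkEdges → (((0 : ℕ), u), ((1 : ℕ), v)) ∈ stepEdges := fun u v h =>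
    List.mem_append_right _ (List.mem_map.2 ⟨_, h, rfl⟩)
  rcases h with ⟨hij, h | h⟩ | ⟨hij, h⟩ | ⟨hij, h⟩
  · exact ⟨i, _, cell _ _ h, .inl (by simp_all)⟩
  · exact ⟨i, _, cell _ _ h, .inr (by simp_all)⟩
  · exact ⟨i, _, link _ _ h, .inl (by simp_all)⟩
  · exact ⟨j, _, link _ _ h, .inr (by simp_all)⟩

/-- The position of a vertex of the nested triangulation. -/
noncomputable def vertexPos {k : ℕ} (p : Fin k × Fin 22) : ℝ × ℝ := nestedPos p.1 p.2

theorem vertexPos_injective (k : ℕ) : Function.Injective (vertexPos (k := k)) := by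
  intro p q h
  have := nestedPos_injective (a₁ := (p.1, p.2)) (a₂ := (q.1, q.2)) h
  simp only [Prod.mk.injEq] at this
  exact Prod.ext (Fin.ext this.1) this.2

theorem nested_segCompat {k : ℕ} {p q r s : Fin k × Fin 22} (h₁ : (nested k).Adj p q)
    (h₂ : (nested k).Adj r s) (hne : s(p, q) ≠ s(r, s)) :
    SegCompat (vertexPos p) (vertexPos q) (vertexPos r) (vertexPos s) := by
  obtain ⟨i, e, he, hi⟩ := nested_adj_exists h₁
  obtain ⟨j, f, hf, hj⟩ := nested_adj_exists h₂
  have eqs : ∀ {p : Fin k × Fin 22} {i : ℕ} {x : ℕ × Fin 22}, ((p.1 : ℕ), p.2) = (i + x.1, x.2) →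
      vertexPos p = shiftPos i x := by
    intro p i x h
    simp only [Prod.mk.injEq] at h
    rw [vertexPos, shiftPos, h.1, h.2]
  have inj : ∀ {p q : Fin k × Fin 22} {x : ℕ × Fin 22}, ((p.1 : ℕ), p.2) = x →
      ((q.1 : ℕ), q.2) = x → p = q := by
    rintro p q x rfl h
    simp only [Prod.mk.injEq] at h
    exact Prod.ext (Fin.ext h.1.symm) h.2.symm
  have hef : ¬ (i = j ∧ e = f) := by
    rintro ⟨rfl, rfl⟩
    rcases hi with ⟨hp, hq⟩ | ⟨hq, hp⟩ <;> rcases hj with ⟨hr, hs⟩ | ⟨hs, hr⟩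
    · exact hne (by rw [inj hp hr, inj hq hs])
    · exact hne (by rw [inj hp hs, inj hq hr, Sym2.eq_swap])
    · exact hne (by rw [inj hp hs, inj hq hr, Sym2.eq_swap])
    · exact hne (by rw [inj hp hr, inj hq hs])
  have key := stepEdges_segCompat he hf i j hef
  rcases hi with ⟨hp, hq⟩ | ⟨hq, hp⟩ <;> rcases hj with ⟨hr, hs⟩ | ⟨hs, hr⟩ <;>
    rw [eqs hp, eqs hq, eqs hr, eqs hs]
  · exact key
  · exact key.swap_right
  · exact key.swap_left
  · exact key.swap_left.swap_right

theorem exists_cellAdj : ∀ u, ∃ v, CellAdj u v := by decide +kernel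

/-- The straight-line drawing of the nested triangulation. -/
noncomputable def nestedEmbedding (k : ℕ) : PlaneEmbedding (nested k) :=
  .ofSegments vertexPos (vertexPos_injective k)
    (by
      rintro p q h ⟨i, w⟩ hw
      by_contra! hne
      obtain ⟨x, hx⟩ := exists_cellAdj w
      have hadj : (nested k).Adj (i, w) (i, x) := .inl ⟨rfl, hx⟩
      have hs : s(p, q) ≠ s((i, w), (i, x)) := by
        intro hs
        have : (i, w) ∈ s(p, q) := hs ▸ Sym2.mem_mk_left _ _
        rcases Sym2.mem_iff.1 this with h | h
        · exact hne.1 h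
        · exact hne.2 h
      rcases (nested_segCompat h hadj hs ⟨hw, left_mem_segment ℝ _ _⟩).1 with h | h
      · exact hne.1 (vertexPos_injective k h)
      · exact hne.2 (vertexPos_injective k h))
    (fun _ _ _ _ => nested_segCompat)

theorem nested_isPlaneTriangulation (k : ℕ) : IsPlaneTriangulation (nested k) :=
  ⟨⟨nestedEmbedding k⟩, not_isPlanar_sup_edge_of_rank nested_adj_of_rank_eq nested_step⟩

section Polygon

/-- The closed region bounded by the edge lines of a counterclockwise polygon. -/
def polygonRegion {n : ℕ} [NeZero n] (Q : Fin n → ℝ × ℝ) : Set (ℝ × ℝ) :=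
  {X | ∀ i, 0 ≤ orient (Q i) (Q (i + 1)) X}

theorem continuous_orient (P Q : ℝ × ℝ) : Continuous (orient P Q) := by
  unfold orient
  fun_prop

theorem mem_segment_of_orient {P A B R X : ℝ × ℝ} (hP : 0 < orient P A B) (hR : 0 < orient A B R)
    (hX : orient A B X = 0) (hPX : 0 ≤ orient P A X) (hRX : 0 ≤ orient B R X) :
    X ∈ segment ℝ A B := by
  have e1 : orient P A B * X.1 = (orient P A B - orient P A X) * A.1 + orient P A X * B.1 +
      orient A B X * (P.1 - A.1) := by
    simp only [orient]; ring
  have e2 : orient P A B * X.2 = (orient P A B - orient P A X) * A.2 + orient P A X * B.2 +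
      orient A B X * (P.2 - A.2) := by
    simp only [orient]; ring
  set D := orient P A B
  have hle : orient P A X ≤ D := by
    have key : D * orient B R X = (D - orient P A X) * orient A B R +
        orient A B X * orient B R P - orient A B X * orient A B R := by
      simp only [D, orient]; ring
    rw [hX] at key
    by_contra! h
    nlinarith [mul_nonneg hP.le hRX, mul_pos (sub_pos.2 h) hR]
  rw [hX] at e1 e2
  refine ⟨1 - orient P A X / D, orient P A X / D, ?_, by positivity, by ring, ?_⟩
  · rw [sub_nonneg]
    exact (div_le_one hP).2 hle
  · ext
    · simp only [Prod.fst_add, Prod.smul_fst, smul_eq_mul]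
      field_simp
      linarith
    · simp only [Prod.snd_add, Prod.smul_snd, smul_eq_mul]
      field_simp
      linarith

theorem isBounded_triangle (A B C : ℝ × ℝ) (h : 0 < orient A B C) :
    Bornology.IsBounded {X | 0 ≤ orient A B X ∧ 0 ≤ orient B C X ∧ 0 ≤ orient C A X} := by
  have hb : Bornology.IsBounded (convexHull ℝ {A, B, C}) :=
    isBounded_convexHull.2 (Set.toFinite _).isBounded
  refine hb.subset ?_
  rintro X ⟨h1, h2, h3⟩
  have hs : orient A B X + orient B C X + orient C A X = orient A B C := by
    simp only [orient]; ring
  have e1 : orient A B C * X.1 =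
      orient B C X * A.1 + orient C A X * B.1 + orient A B X * C.1 := by
    simp only [orient]; ring
  have e2 : orient A B C * X.2 =
      orient B C X * A.2 + orient C A X * B.2 + orient A B X * C.2 := by
    simp only [orient]; ring
  have hX : X = ∑ i, (![orient B C X, orient C A X, orient A B X] i / orient A B C) •
      ![A, B, C] i := by
    simp only [Fin.sum_univ_three]
    ext
    · simp
      field_simp
      linarith
    · simp
      field_simp
      linarith
  rw [hX]
  refine (convex_convexHull ℝ _).sum_mem ?_ ?_ ?_
  · intro i _
    fin_cases i <;> simp <;> positivity
  · simp only [Fin.sum_univ_three]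
    simp
    field_simp
    linarith
  · intro i _
    apply subset_convexHull
    fin_cases i <;> simp

theorem isBounded_polygonRegion_three (Q : Fin 3 → ℝ × ℝ)
    (h : ∀ i, 0 < orient (Q i) (Q (i + 1)) (Q (i + 1 + 1))) :
    Bornology.IsBounded (polygonRegion Q) :=
  (isBounded_triangle _ _ _ (h 0)).subset fun _ hX => ⟨hX 0, hX 1, hX 2⟩

theorem isBounded_polygonRegion_four (Q : Fin 4 → ℝ × ℝ)
    (h : ∀ i, 0 < orient (Q i) (Q (i + 1)) (Q (i + 1 + 1))) :
    Bornology.IsBounded (polygonRegion Q) := by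
  refine ((isBounded_triangle (Q 0) (Q 1) (Q 2) (h 0)).union
    (isBounded_triangle (Q 2) (Q 3) (Q 0) (h 2))).subset fun X hX => ?_
  have hs : orient (Q 2) (Q 0) X = - orient (Q 0) (Q 2) X := by simp only [orient]; ring
  rcases le_total 0 (orient (Q 2) (Q 0) X) with h0 | h0
  · exact .inl ⟨hX 0, hX 1, h0⟩
  · exact .inr ⟨hX 2, hX 3, by linarith⟩

/-- A vertex strictly inside a convex polygon covered by the drawing is not on the boundary
of the outer face. -/
theorem not_outerplaneOn_of_polygon {V : Type} {G : SimpleGraph V} (E : PlaneEmbedding G)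
    {S : Set V} {n : ℕ} [NeZero n] (Q : Fin n → ℝ × ℝ)
    (hconv : ∀ i, 0 < orient (Q i) (Q (i + 1)) (Q (i + 1 + 1)))
    (hseg : ∀ i, segment ℝ (Q i) (Q (i + 1)) ⊆ E.subSupport S)
    (hbdd : Bornology.IsBounded (polygonRegion Q)) {v : V} (hv : v ∈ S)
    (hvI : ∀ i, 0 < orient (Q i) (Q (i + 1)) (E.vtx v)) : ¬ E.OuterplaneOn S := by
  intro hout
  set I : Set (ℝ × ℝ) := {X | ∀ i, 0 < orient (Q i) (Q (i + 1)) X} with hI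
  have hIo : IsOpen I := by
    rw [hI, Set.ofPred_forall]
    exact isOpen_iInter_of_finite fun i =>
      isOpen_lt continuous_const (continuous_orient _ _)
  have hCc : IsClosed (polygonRegion Q) := by
    rw [polygonRegion, Set.ofPred_forall]
    exact isClosed_iInter fun i => isClosed_le continuous_const (continuous_orient _ _)
  have hIC : I ⊆ polygonRegion Q := fun X hX i => (hX i).le
  obtain ⟨X, hXI, hXS, hXu⟩ := mem_closure_iff.1 (hout v hv) I hIo hvI
  apply hXu
  refine hbdd.subset (.trans ?_ hIC)
  have hmem : X ∈ connectedComponentIn (E.subSupport S)ᶜ X := mem_connectedComponentIn hXS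
  refine isPreconnected_connectedComponentIn.subset_left_of_subset_union hIo hCc.isOpen_compl
    (Set.disjoint_compl_right_iff_subset.2 hIC) ?_ ⟨X, hmem, hXI⟩
  intro Y hY
  by_contra hYn
  rw [Set.mem_union, not_or, Set.notMem_compl_iff] at hYn
  obtain ⟨hYI, hYC⟩ := hYn
  simp only [hI, Set.mem_ofPred_eq, not_forall, not_lt] at hYI
  obtain ⟨i, hi⟩ := hYI
  refine connectedComponentIn_subset _ _ hY (hseg i ?_)
  have h1 := hconv (i - 1)
  have h2 := hYC (i - 1)
  have h3 := hYC (i + 1)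
  rw [sub_add_cancel] at h1 h2
  exact mem_segment_of_orient h1 (hconv i) (le_antisymm hi (hYC i)) h2 h3

end Polygon

/-- The cycle `Q` of a level is drawn as a counterclockwise convex polygon around `w`. -/
def Encloses {n : ℕ} [NeZero n] (Q : Fin n → Fin 22) (w : Fin 22) : Prop :=
  ∀ i, CellAdj (Q i) (Q (i + 1)) ∧
    0 < orient (cellPos (Q i)) (cellPos (Q (i + 1))) (cellPos (Q (i + 1 + 1))) ∧
    0 < orient (cellPos (Q i)) (cellPos (Q (i + 1))) (cellPos w)

instance {n : ℕ} [NeZero n] (Q : Fin n → Fin 22) (w : Fin 22) : Decidable (Encloses Q w) :=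
  inferInstanceAs (Decidable (∀ _, _ ∧ _ ∧ _))

theorem Encloses.not_outerplaneOn {k n : ℕ} [NeZero n] {Q : Fin n → Fin 22} {w : Fin 22}
    (h : Encloses Q w) {j : Fin k} {S : Set (Fin k × Fin 22)} (hQ : ∀ i, (j, Q i) ∈ S)
    (hw : (j, w) ∈ S)
    (hbdd : ∀ P : Fin n → ℝ × ℝ, (∀ i, 0 < orient (P i) (P (i + 1)) (P (i + 1 + 1))) →
      Bornology.IsBounded (polygonRegion P)) : ¬ (nestedEmbedding k).OuterplaneOn S := by
  have pos : ∀ a b c, 0 < orient (cellPos a) (cellPos b) (cellPos c) →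
      0 < orient (nestedPos j a) (nestedPos j b) (nestedPos j c) := by
    intro a b c habc
    rw [nestedPos, nestedPos, nestedPos, orient_scaled]
    have : (0 : ℝ) < ((orient (cellPos a) (cellPos b) (cellPos c) : ℤ) : ℝ) := by
      exact_mod_cast habc
    positivity
  have hconv := fun i => pos _ _ _ (h i).2.1
  refine not_outerplaneOn_of_polygon _ (fun i => nestedPos j (Q i)) hconv (fun i X hX => .inr ?_)
    (hbdd _ hconv) hw fun i => pos _ _ _ (h i).2.2
  simp only [Set.mem_iUnion]
  exact ⟨(j, Q i), hQ i, (j, Q (i + 1)), hQ (i + 1), .inl ⟨rfl, (h i).1⟩, hX⟩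

section Counting

variable {k : ℕ} {S : Finset (Fin k × Fin 22)} (j : Fin k)

theorem Encloses.indicator_three (hS : (nestedEmbedding k).OuterplaneOn ↑S) {a b c w : Fin 22}
    (h : Encloses ![a, b, c] w) {x : Fin 22 → ℕ} (hx : ∀ v, x v = if (j, v) ∈ S then 1 else 0) :
    x a + x b + x c + x w ≤ 3 := by
  by_contra hlt
  simp only [hx] at hlt
  refine h.not_outerplaneOn (j := j) (S := ↑S) ?_ ?_ isBounded_polygonRegion_three hS
  · have hmem : (j, a) ∈ S ∧ (j, b) ∈ S ∧ (j, c) ∈ S := by grind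
    simpa [Fin.forall_fin_succ] using hmem
  · rw [Finset.mem_coe]
    grind

theorem Encloses.indicator_four (hS : (nestedEmbedding k).OuterplaneOn ↑S) {a b c d w : Fin 22}
    (h : Encloses ![a, b, c, d] w) {x : Fin 22 → ℕ}
    (hx : ∀ v, x v = if (j, v) ∈ S then 1 else 0) :
    x a + x b + x c + x d + x w ≤ 4 := by
  by_contra hlt
  simp only [hx] at hlt
  refine h.not_outerplaneOn (j := j) (S := ↑S) ?_ ?_ isBounded_polygonRegion_four hS
  · have hmem : (j, a) ∈ S ∧ (j, b) ∈ S ∧ (j, c) ∈ S ∧ (j, d) ∈ S := by grind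
    simpa [Fin.forall_fin_succ] using hmem
  · rw [Finset.mem_coe]
    grind

/-- The vertices of the three inner faces: in each face an outer triangle `0, 1, 2` in
counterclockwise order, followed by its inner triangle `3, 4, 5`. -/
def faceVertex : Fin 3 → Fin 6 → Fin 22 :=
  ![![4, 5, 6, 7, 8, 9], ![12, 11, 10, 14, 13, 15], ![16, 17, 18, 19, 20, 21]]

/-- The three inner faces around the centre, in counterclockwise order. -/
def faceHost : Fin 3 → Fin 3 → Fin 22 := ![![0, 1, 3], ![0, 3, 2], ![1, 2, 3]]

theorem encloses_root : ∀ f i, Encloses ![0, 1, 2] (faceVertex f i) ∧ Encloses ![0, 1, 2] 3 := by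
  decide +kernel

theorem encloses_host : ∀ f i, Encloses ![faceHost f 0, faceHost f 1, faceHost f 2]
    (faceVertex f i) := by
  decide +kernel

theorem encloses_face : ∀ f : Fin 3, let F := faceVertex f
    (Encloses ![F 0, F 1, F 2] (F 3) ∧ Encloses ![F 0, F 1, F 2] (F 4) ∧
      Encloses ![F 0, F 1, F 2] (F 5)) ∧
    Encloses ![F 1, F 2, F 5, F 3] (F 4) ∧ Encloses ![F 2, F 0, F 3, F 4] (F 5) ∧
      Encloses ![F 0, F 1, F 4, F 5] (F 3) := by
  decide +kernel

theorem sum_univ_eq_face_sum (x : Fin 22 → ℕ) :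
    ∑ v, x v = x 0 + x 1 + x 2 + x 3 + ∑ f, ∑ i, x (faceVertex f i) := by
  rw [Fin.sum_univ_def, show List.finRange 22 = [0, 1, 2, 3, 4, 5, 6, 7, 8, 9, 10, 11, 12, 13, 14,
    15, 16, 17, 18, 19, 20, 21] from rfl]
  simp only [List.map_cons, List.map_nil, List.sum_cons, List.sum_nil, Fin.sum_univ_three,
    Fin.sum_univ_six]
  change _ = x 0 + x 1 + x 2 + x 3 + ((x 4 + x 5 + x 6 + x 7 + x 8 + x 9) +
    (x 12 + x 11 + x 10 + x 14 + x 13 + x 15) + (x 16 + x 17 + x 18 + x 19 + x 20 + x 21))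
  ring

theorem level_card_le (hS : (nestedEmbedding k).OuterplaneOn ↑S) :
    (S.filter fun p => p.1 = j).card ≤ 14 := by
  set x : Fin 22 → ℕ := fun v => if (j, v) ∈ S then 1 else 0 with hxdef
  have hx : ∀ v, x v = if (j, v) ∈ S then 1 else 0 := fun v => rfl
  have hcard : (S.filter fun p => p.1 = j).card ≤ ∑ v, x v := by
    rw [hxdef, ← Finset.card_filter]
    refine Finset.card_le_card_of_injOn Prod.snd ?_ ?_
    · rintro ⟨i, v⟩ hp
      simp only [Finset.coe_filter, Set.mem_ofPred_eq] at hp ⊢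
      exact ⟨Finset.mem_univ v, hp.2 ▸ hp.1⟩
    · rintro ⟨i, u⟩ hp ⟨i', v⟩ hq huv
      simp only [Finset.coe_filter, Set.mem_ofPred_eq] at hp hq
      exact Prod.ext (hp.2.trans hq.2.symm) huv
  have hle : ∀ v, x v ≤ 1 := fun v => by
    rw [hx]
    split_ifs <;> omega
  have hblock : ∀ f, ∑ i, x (faceVertex f i) ≤ 4 := by
    intro f
    obtain ⟨⟨h1, h2, h3⟩, h4, h5, h6⟩ := encloses_face f
    have h1 := h1.indicator_three j hS hx
    have h2 := h2.indicator_three j hS hx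
    have h3 := h3.indicator_three j hS hx
    have h4 := h4.indicator_four j hS hx
    have h5 := h5.indicator_four j hS hx
    have h6 := h6.indicator_four j hS hx
    have := hle (faceVertex f 0)
    have := hle (faceVertex f 1)
    have := hle (faceVertex f 2)
    rw [Fin.sum_univ_six]
    omega
  have hempty : ∀ {a b c : Fin 22} (f : Fin 3), (∀ i, Encloses ![a, b, c] (faceVertex f i)) →
      x a + x b + x c = 3 → ∑ i, x (faceVertex f i) = 0 := by
    intro a b c f h habc
    refine Finset.sum_eq_zero fun i _ => ?_
    have := (h i).indicator_three j hS hx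
    omega
  have hroot := fun f => hempty f fun i => (encloses_root f i).1
  have hcentre := (encloses_root 0 0).2.indicator_three j hS hx
  have hhost := fun f => hempty f (encloses_host f)
  rw [sum_univ_eq_face_sum, Fin.sum_univ_three] at hcard
  have b0 := hblock 0
  have b1 := hblock 1
  have b2 := hblock 2
  have r0 := hroot 0
  have r1 := hroot 1
  have r2 := hroot 2
  have t0 : x 0 + x 1 + x 3 = 3 → _ := hhost 0
  have t1 : x 0 + x 3 + x 2 = 3 → _ := hhost 1
  have t2 : x 1 + x 2 + x 3 = 3 → _ := hhost 2
  have := hle 0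
  have := hle 1
  have := hle 2
  have := hle 3
  omega

theorem outerplaneOn_card_le (hS : (nestedEmbedding k).OuterplaneOn ↑S) : S.card ≤ 14 * k :=
  calc S.card ≤ 14 * (S.image Prod.fst).card :=
        Finset.card_le_mul_card_image S 14 fun j _ => level_card_le j hS
    _ ≤ 14 * k := by
        gcongr
        simpa using Finset.card_le_univ (S.image Prod.fst)

end Counting

theorem sO'_nestedEmbedding_le (k : ℕ) : sO' (nestedEmbedding k) ≤ 14 * k := by
  refine csSup_le' ?_
  rintro n ⟨S, hS, rfl⟩
  exact outerplaneOn_card_le hS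

section Parabola

/-- The point of the parabola `y = x ^ 2` with first coordinate `n`. -/
def parabolaPoint (n : ℕ) : ℝ × ℝ := (n, (n : ℝ) ^ 2)

theorem orient_parabolaPoint (a b c : ℕ) :
    orient (parabolaPoint a) (parabolaPoint b) (parabolaPoint c) =
      ((b : ℝ) - a) * (c - a) * (c - b) := by
  simp only [orient, parabolaPoint]
  ring

theorem orient_parabolaPoint_ne_zero {a b c : ℕ} (hab : a ≠ b) (hac : a ≠ c) (hbc : b ≠ c) :
    orient (parabolaPoint a) (parabolaPoint b) (parabolaPoint c) ≠ 0 := by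
  rw [orient_parabolaPoint]
  have h1 : (b : ℝ) ≠ a := mod_cast hab.symm
  have h2 : (c : ℝ) ≠ a := mod_cast hac.symm
  have h3 : (c : ℝ) ≠ b := mod_cast hbc.symm
  exact mul_ne_zero (mul_ne_zero (sub_ne_zero.2 h1) (sub_ne_zero.2 h2)) (sub_ne_zero.2 h3)

theorem segCompat_parabolaPoint {a b c d : ℕ} (hab : a < b) (hcd : c < d)
    (hne : ¬ (a = c ∧ b = d)) (h₁ : ¬ (a < c ∧ c < b ∧ b < d)) (h₂ : ¬ (c < a ∧ a < d ∧ d < b)) :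
    SegCompat (parabolaPoint a) (parabolaPoint b) (parabolaPoint c) (parabolaPoint d) := by
  have pos : ∀ {x y : ℕ}, x < y → (0 : ℝ) < y - x := fun h => sub_pos.2 (mod_cast h)
  by_cases hac : a = c
  · subst hac
    exact segCompat_of_common (orient_parabolaPoint_ne_zero (by omega) (by omega) (by omega))
  by_cases had : a = d
  · subst had
    exact (segCompat_of_common
      (orient_parabolaPoint_ne_zero (by omega) (by omega) (by omega))).swap_right
  by_cases hbc : b = c
  · subst hbc
    exact (segCompat_of_common
      (orient_parabolaPoint_ne_zero (by omega) (by omega) (by omega))).swap_left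
  by_cases hbd : b = d
  · subst hbd
    exact (segCompat_of_common
      (orient_parabolaPoint_ne_zero (by omega) (by omega) (by omega))).swap_left.swap_right
  have hprod : ∀ x : ℕ, (x < a ∨ b < x) → 0 < ((x : ℝ) - a) * (x - b) := by
    rintro x (h | h)
    · exact mul_pos_of_neg_of_neg (by linarith [pos h]) (by linarith [pos h, pos hab])
    · exact mul_pos (by linarith [pos h, pos hab]) (pos h)
  have hprod' : ∀ x : ℕ, (a < x ∧ x < b) → ((x : ℝ) - a) * (x - b) < 0 := fun x h =>
    mul_neg_of_pos_of_neg (pos h.1) (by linarith [pos h.2])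
  have hmul : 0 < (((c : ℝ) - a) * (c - b)) * ((d - a) * (d - b)) := by
    by_cases hin : a < c ∧ c < b
    · exact mul_pos_of_neg_of_neg (hprod' c hin) (hprod' d (by omega))
    · exact mul_pos (hprod c (by omega)) (hprod d (by omega))
  apply segCompat_of_orient_mul_pos
  rw [orient_parabolaPoint, orient_parabolaPoint]
  calc (0 : ℝ) < ((b - a) ^ 2) * ((((c : ℝ) - a) * (c - b)) * ((d - a) * (d - b))) :=
        mul_pos (pow_pos (pos hab) 2) hmul
    _ = _ := by ring

/-- The region below the parabola. -/
def belowParabola : Set (ℝ × ℝ) := {X | X.2 < X.1 ^ 2}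

theorem isPreconnected_belowParabola : IsPreconnected belowParabola := by
  have : belowParabola = (fun X : ℝ × ℝ => (X.1, X.1 ^ 2 - X.2)) '' (Set.univ ×ˢ Set.Ioi 0) := by
    ext ⟨x, y⟩
    simp only [belowParabola, Set.mem_ofPred_eq, Set.mem_image, Set.mem_prod, Set.mem_univ,
      true_and, Set.mem_Ioi, Prod.exists, Prod.mk.injEq]
    exact ⟨fun h => ⟨x, x ^ 2 - y, by linarith, rfl, by ring⟩,
      fun ⟨a, b, hb, ha, hy⟩ => by subst ha; linarith⟩
  rw [this]
  exact (isPreconnected_univ.prod isPreconnected_Ioi).image _ (by fun_prop)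

theorem not_isBounded_belowParabola : ¬ Bornology.IsBounded belowParabola := by
  intro h
  obtain ⟨r, hr⟩ := h.subset_closedBall 0
  have hmem : ((0, -(|r| + 1)) : ℝ × ℝ) ∈ belowParabola := by
    simp only [belowParabola, Set.mem_ofPred_eq]
    linarith [abs_nonneg r]
  have := hr hmem
  rw [mem_closedBall_zero_iff] at this
  have h2 := (norm_snd_le ((0, -(|r| + 1)) : ℝ × ℝ)).trans this
  rw [Real.norm_eq_abs, abs_neg, abs_of_nonneg (by positivity)] at h2
  linarith [le_abs_self r]

theorem parabolaPoint_mem_closure (n : ℕ) : parabolaPoint n ∈ closure belowParabola := by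
  refine mem_closure_of_tendsto (b := Filter.atTop)
    (f := fun m : ℕ => ((n : ℝ), (n : ℝ) ^ 2 - 1 / ((m : ℝ) + 1))) ?_ (.of_forall fun m => ?_)
  · have := (tendsto_const_nhds (x := (n : ℝ) ^ 2)).sub
      (tendsto_one_div_add_atTop_nhds_zero_nat (𝕜 := ℝ))
    rw [sub_zero] at this
    exact tendsto_const_nhds.prodMk_nhds this
  · have : 0 < 1 / ((m : ℝ) + 1) := by positivity
    simp only [belowParabola, Set.mem_ofPred_eq]
    linarith

theorem notMem_belowParabola_of_mem_segment {a b : ℕ} {X : ℝ × ℝ}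
    (h : X ∈ segment ℝ (parabolaPoint a) (parabolaPoint b)) : X ∉ belowParabola := by
  obtain ⟨t, h0, h1, rfl, -⟩ := exists_orient_eq_of_mem_segment h
  simp only [belowParabola, parabolaPoint, Set.mem_ofPred_eq, not_lt]
  nlinarith [mul_nonneg (mul_nonneg h0 (sub_nonneg.2 h1)) (sq_nonneg ((a : ℝ) - b))]

/-- A graph with a linear vertex order without interleaving edges is outerplanar. -/
theorem isOuterplanar_of_order {V : Type} {G : SimpleGraph V} (o : V → ℕ)
    (ho : Function.Injective o)
    (hcross : ∀ ⦃u v a b : V⦄, G.Adj u v → G.Adj a b → ¬ (o u < o a ∧ o a < o v ∧ o v < o b)) :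
    IsOuterplanar G := by
  have hinj : Function.Injective fun v => parabolaPoint (o v) := fun u v h =>
    ho (Nat.cast_injective (R := ℝ) (congrArg Prod.fst h))
  have hvtx : ∀ ⦃u v : V⦄, G.Adj u v → ∀ w,
      parabolaPoint (o w) ∈ segment ℝ (parabolaPoint (o u)) (parabolaPoint (o v)) →
        w = u ∨ w = v := by
    intro u v huv w hw
    by_contra! hne
    exact orient_parabolaPoint_ne_zero (ho.ne huv.ne) (ho.ne hne.1.symm) (ho.ne hne.2.symm)
      (orient_eq_zero_of_mem_segment hw)
  have hlt : ∀ ⦃u v a b : V⦄, G.Adj u v → G.Adj a b → s(u, v) ≠ s(a, b) → o u < o v → o a < o b →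
      SegCompat (parabolaPoint (o u)) (parabolaPoint (o v)) (parabolaPoint (o a))
        (parabolaPoint (o b)) := fun u v a b huv hab hne h₁ h₂ =>
    segCompat_parabolaPoint h₁ h₂ (fun h => hne (by rw [ho h.1, ho h.2])) (hcross huv hab)
      (hcross hab huv)
  have hinter : ∀ ⦃u v a b : V⦄, G.Adj u v → G.Adj a b → s(u, v) ≠ s(a, b) →
      SegCompat (parabolaPoint (o u)) (parabolaPoint (o v)) (parabolaPoint (o a))
        (parabolaPoint (o b)) := by
    intro u v a b huv hab hne
    rcases lt_or_gt_of_ne (ho.ne huv.ne) with h₁ | h₁ <;>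
      rcases lt_or_gt_of_ne (ho.ne hab.ne) with h₂ | h₂
    · exact hlt huv hab hne h₁ h₂
    · exact (hlt huv hab.symm (by rwa [Sym2.eq_swap (a := b)]) h₁ h₂).swap_right
    · exact (hlt huv.symm hab (by rwa [Sym2.eq_swap (a := v)]) h₁ h₂).swap_left
    · exact (hlt huv.symm hab.symm (by rwa [Sym2.eq_swap (a := v), Sym2.eq_swap (a := b)])
        h₁ h₂).swap_left.swap_right
  refine ⟨.ofSegments _ hinj hvtx hinter, fun v _ => ?_⟩
  set E := PlaneEmbedding.ofSegments _ hinj hvtx hinter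
  have hsub : belowParabola ⊆ (E.subSupport Set.univ)ᶜ := by
    rintro X hX (⟨u, -, rfl⟩ | hX')
    · exact notMem_belowParabola_of_mem_segment
        (left_mem_segment ℝ (parabolaPoint (o u)) (parabolaPoint (o u))) hX
    · simp only [Set.mem_iUnion] at hX'
      obtain ⟨_, _, _, _, _, hseg⟩ := hX'
      exact notMem_belowParabola_of_mem_segment hseg hX
  refine closure_mono (s := belowParabola) ?_ (parabolaPoint_mem_closure (o v))
  refine fun X hX => ⟨hsub hX, fun hb => ?_⟩
  exact not_isBounded_belowParabola
    (hb.subset (isPreconnected_belowParabola.subset_connectedComponentIn hX hsub))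

end Parabola

section InducedOuterplanar

/-- The vertices of a level in the large outerplanar set, in the order of a drawing with all
vertices on the outer face. -/
def outerOrder : List (Fin 22) := [1, 16, 19, 20, 21, 2, 11, 13, 15, 14, 3, 5, 7, 9, 8]

theorem outerOrder_nodup : outerOrder.Nodup := by decide

theorem not_mem_linkEdges : ∀ u ∈ outerOrder, ∀ v ∈ outerOrder, (u, v) ∉ linkEdges := by
  decide +kernel

theorem outerOrder_not_interleaved : ∀ u ∈ outerOrder, ∀ v ∈ outerOrder, CellAdj u v →
    ∀ a ∈ outerOrder, ∀ b ∈ outerOrder, CellAdj a b →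
      ¬ (outerOrder.idxOf u < outerOrder.idxOf a ∧ outerOrder.idxOf a < outerOrder.idxOf v ∧
        outerOrder.idxOf v < outerOrder.idxOf b) := by
  decide +kernel

/-- A set of fifteen vertices in each level inducing an outerplanar graph. -/
def outerSet (k : ℕ) : Finset (Fin k × Fin 22) := Finset.univ ×ˢ outerOrder.toFinset

theorem card_outerSet (k : ℕ) : (outerSet k).card = 15 * k := by
  rw [outerSet, Finset.card_product, List.toFinset_card_of_nodup outerOrder_nodup,
    Finset.card_univ, Fintype.card_fin, mul_comm]
  rfl

theorem isOuterplanar_induce_outerSet (k : ℕ) :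
    IsOuterplanar ((nested k).induce (↑(outerSet k) : Set (Fin k × Fin 22))) := by
  have hmem : ∀ p : ((↑(outerSet k) : Set (Fin k × Fin 22))), p.1.2 ∈ outerOrder := fun p =>
    List.mem_toFinset.1 (Finset.mem_product.1 (Finset.mem_coe.1 p.2)).2
  have hidx : ∀ p : ((↑(outerSet k) : Set (Fin k × Fin 22))), outerOrder.idxOf p.1.2 < 15 :=
    fun p => List.idxOf_lt_length_of_mem (hmem p)
  have hadj : ∀ p q, ((nested k).induce (↑(outerSet k) : Set (Fin k × Fin 22))).Adj p q →
      p.1.1 = q.1.1 ∧ CellAdj p.1.2 q.1.2 := by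
    rintro p q (h | h | h)
    · exact h
    · exact absurd h.2 (not_mem_linkEdges _ (hmem p) _ (hmem q))
    · exact absurd h.2 (not_mem_linkEdges _ (hmem q) _ (hmem p))
  refine isOuterplanar_of_order (fun p => 15 * (p.1.1 : ℕ) + outerOrder.idxOf p.1.2) ?_ ?_
  · intro p q hpq
    have hp := hidx p
    have hq := hidx q
    simp only at hpq
    refine Subtype.ext (Prod.ext (Fin.ext (by omega)) ?_)
    exact (List.idxOf_inj (hmem p)).1 (by omega)
  · intro p q a b hpq hab hlt
    obtain ⟨e₁, h₁⟩ := hadj p q hpq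
    obtain ⟨e₂, h₂⟩ := hadj a b hab
    have hp := hidx p
    have hq := hidx q
    have ha := hidx a
    have hb := hidx b
    simp only [e₁, e₂] at hlt
    have e₃ : (a.1.1 : ℕ) = q.1.1 := by omega
    refine outerOrder_not_interleaved _ (hmem p) _ (hmem q) h₁ _ (hmem a) _ (hmem b) h₂ ?_
    omega

theorem le_sO_nested (k : ℕ) : 15 * k ≤ sO (nested k) := by
  refine le_csSup ⟨Fintype.card (Fin k × Fin 22), ?_⟩
    ⟨outerSet k, isOuterplanar_induce_outerSet k, card_outerSet k⟩
  rintro n ⟨S, -, rfl⟩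
  exact S.card_le_univ

end InducedOuterplanar

/-- For every `k ≥ 4` there exists a plane triangulation `G_k` of order
`22k` with `s_o(G_k) ≥ 15k` and `s_{o'}(G_k) ≤ 14k`; in particular
`s_o(G_k) − s_{o'}(G_k) ≥ k`. -/
theorem stmt7 (k : ℕ) (hk : 4 ≤ k) :
    ∃ (V : Type) (inst : Fintype V) (G : SimpleGraph V) (E : PlaneEmbedding G),
      IsPlaneTriangulation G ∧
      @Fintype.card V inst = 22 * k ∧
      15 * k ≤ @sO V inst G ∧
      @sO' V inst G E ≤ 14 * k ∧
      @sO' V inst G E + k ≤ @sO V inst G := by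
  have h₁ := le_sO_nested k
  have h₂ := sO'_nestedEmbedding_le k
  exact ⟨Fin k × Fin 22, inferInstance, nested k, nestedEmbedding k, nested_isPlaneTriangulation k,
    by simp [mul_comm], h₁, h₂, by omega⟩
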